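/- arXiv:1508.07167 — 2 statements merged into one kernel-verified Lean document; each statement's English description precedes it below -/
import Mathlib

section
/- Suppose ω is a modulus of continuity with limsup_{δ→0+} ω(δ)/√δ = ∞. Then there exists a complex-valued function f ∈ Lip_ω(𝕋) such that for every homeomorphism h of the circle 𝕋 onto itself, the superposition f∘h does not belong to W_2^{1/2}(𝕋), i.e. ∑_{k∈ℤ} |\widehat{f∘h}(k)|²|k| = ∞. -/
open Real MeasureTheory Filter

noncomputable section

instance : Fact (0 < 2 * Real.pi) := ⟨by positivity⟩

/-- A modulus of continuity: a nondecreasing continuous function `ω : [0,∞) → [0,∞)`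
with `ω 0 = 0` and `ω (x+y) ≤ ω x + ω y`. -/
def IsModulusOfContinuity (ω : ℝ → ℝ) : Prop :=
  ContinuousOn ω (Set.Ici 0) ∧ MonotoneOn ω (Set.Ici 0) ∧ ω 0 = 0 ∧
    (∀ x : ℝ, 0 ≤ x → 0 ≤ ω x) ∧
    ∀ x y : ℝ, 0 ≤ x → 0 ≤ y → ω (x + y) ≤ ω x + ω y

section Parseval

variable {T : ℝ} [hT : Fact (0 < T)]

open AddCircle

lemma fourierCoeff_comp_add_right (g : AddCircle T → ℂ) (s : AddCircle T) (n : ℤ) :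
    fourierCoeff (fun x => g (x + s)) n = fourier n s * fourierCoeff g n := by
  simp only [fourierCoeff]
  rw [← integral_add_right_eq_self
      (fun x => fourier (-n) x • g x) s, ← integral_const_mul]
  congr 1
  funext x
  have h1 : fourier n s * fourier (-n) s = (1 : ℂ) := by
    rw [← fourier_add, add_neg_cancel, fourier_zero]
  have h2 : fourier (-n) (x + s) = fourier (-n) x * fourier (-n) s := by
    simp [fourier_apply, smul_add, AddCircle.toCircle_add]
  rw [h2, smul_eq_mul, smul_eq_mul]
  linear_combination (-fourier (-n) x * g (x + s)) * h1

lemma hasSum_sq_fourierCoeff_continuous (g : C(AddCircle T, ℂ)) :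
    HasSum (fun n => ‖fourierCoeff g n‖ ^ 2) (∫ x, ‖g x‖ ^ 2 ∂haarAddCircle) := by
  have h := hasSum_sq_fourierCoeff (ContinuousMap.toLp (E := ℂ) 2 haarAddCircle ℂ g)
  simp only [fourierCoeff_toLp] at h
  convert h using 1
  apply integral_congr_ae
  filter_upwards [ContinuousMap.coeFn_toLp (p := 2) (𝕜 := ℂ) haarAddCircle g] with x hx
  rw [hx]

lemma hasSum_sq_fourierCoeff_shift_add (g : C(AddCircle T, ℂ)) (s : AddCircle T) (c : ℂ) :
    HasSum (fun n => ‖fourierCoeff g n‖ ^ 2 * ‖fourier n s + c‖ ^ 2)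
      (∫ x, ‖g (x + s) + c * g x‖ ^ 2 ∂haarAddCircle) := by
  have h := hasSum_sq_fourierCoeff_continuous
    (g.comp (ContinuousMap.mk (fun x => x + s) (by fun_prop)) + c • g)
  have h1 : Integrable (fun x => g (x + s)) haarAddCircle :=
    (Continuous.integrable_of_hasCompactSupport (by fun_prop)
      (HasCompactSupport.of_compactSpace _))
  have h2 : Integrable (fun x => c * g x) haarAddCircle :=
    (Continuous.integrable_of_hasCompactSupport (by fun_prop)
      (HasCompactSupport.of_compactSpace _))
  have this (n : ℤ) :
      fourierCoeff (⇑(g.comp (ContinuousMap.mk (fun x => x + s) (by fun_prop)) + c • g)) n =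
        (fourier n s + c) * fourierCoeff g n := by
    have h3 := fourierCoeff.add h1 h2 (T := T)
    have h4 := congrFun h3 n
    rw [Pi.add_apply, fourierCoeff_comp_add_right, fourierCoeff.const_mul] at h4
    rw [add_mul, ← h4]
    rfl
  simp_rw [this, norm_mul, mul_pow, mul_comm] at h
  exact h

/-- The shifted symplectic form `∫ Im (conj g(x) · g(x + s)) dx` on the Fourier side. -/
lemma hasSum_sq_fourierCoeff_im (g : C(AddCircle T, ℂ)) (s : AddCircle T) :
    HasSum (fun n => ‖fourierCoeff g n‖ ^ 2 * (fourier n s).im)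
      (∫ x, ((starRingEnd ℂ) (g x) * g (x + s)).im ∂haarAddCircle) := by
  have hI := hasSum_sq_fourierCoeff_shift_add g s Complex.I
  have hJ := hasSum_sq_fourierCoeff_shift_add g s (-Complex.I)
  have key : ∀ z w : ℂ, ((starRingEnd ℂ) w * z).im
      = (1 / 4) * (‖z + Complex.I * w‖ ^ 2 - ‖z + -Complex.I * w‖ ^ 2) := by
    intro z w
    simp [← Complex.normSq_eq_norm_sq, Complex.normSq_apply]
    ring
  have h := (hI.sub hJ).mul_left (1 / 4)
  rw [← integral_sub, ← integral_const_mul] at h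
  · simp_rw [← mul_sub, mul_left_comm (1 / 4 : ℝ)] at h
    have key' (n : ℤ) := key (fourier n s) 1
    simp only [map_one, one_mul, mul_one] at key'
    simp_rw [key, key']
    exact h
  all_goals
    exact Continuous.integrable_of_hasCompactSupport (by fun_prop)
      (HasCompactSupport.of_compactSpace _)

end Parseval

section SobolevHalf

open AddCircle

lemma fourier_coe_two_pi (k : ℤ) (t : ℝ) :
    fourier k (t : AddCircle (2 * π)) = Complex.exp (Complex.I * ((k * t : ℝ) : ℂ)) := by
  rw [fourier_coe_apply]
  congr 1
  have : (π : ℂ) ≠ 0 := by exact_mod_cast pi_ne_zero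
  push_cast
  field_simp

lemma exists_two_pow_le_abs_lt {k : ℤ} (hk : k ≠ 0) :
    ∃ J : ℕ, (2 : ℝ) ^ J ≤ |(k : ℝ)| ∧ |(k : ℝ)| < 2 ^ (J + 1) := by
  refine ⟨Nat.log 2 k.natAbs, ?_, ?_⟩
  · have := Nat.pow_log_le_self 2 (Int.natAbs_ne_zero.2 hk)
    rw [← Int.cast_abs, ← Nat.cast_natAbs]
    exact_mod_cast this
  · have := Nat.lt_pow_succ_log_self (b := 2) (by norm_num) k.natAbs
    rw [← Int.cast_abs, ← Nat.cast_natAbs]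
    exact_mod_cast this

lemma abs_le_dyadic_shift {k : ℤ} (hk : k ≠ 0) :
    ∃ j : ℕ, |(k : ℝ)| ≤
      10 * (2 ^ j * ‖fourier k (((2 ^ j)⁻¹ : ℝ) : AddCircle (2 * π)) + (-1)‖ ^ 2) := by
  obtain ⟨J, h1, h2⟩ := exists_two_pow_le_abs_lt hk
  refine ⟨J + 1, ?_⟩
  rw [fourier_coe_two_pi, ← sub_eq_add_neg, Complex.norm_exp_I_mul_ofReal_sub_one]
  set P : ℝ := 2 ^ (J + 1) with hP
  have hPpos : 0 < P := by positivity
  have h1' : P ≤ 2 * |(k : ℝ)| := by rw [hP, pow_succ]; linarith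
  set y : ℝ := |(k : ℝ) * P⁻¹ / 2| with hy
  have hyeq : y = |(k : ℝ)| / P / 2 := by
    rw [hy, abs_div, abs_mul, abs_of_pos (inv_pos.2 hPpos), abs_of_pos (two_pos (α := ℝ))]; rfl
  have hy1 : 1 / 4 ≤ y := by
    rw [hyeq, div_div, le_div_iff₀ (by positivity)]; linarith
  have hy2 : y ≤ π / 2 := by
    have : |(k : ℝ)| / P ≤ 1 := by rw [div_le_one hPpos]; exact h2.le
    have := pi_gt_three
    rw [hyeq]; linarith
  have hs := mul_le_sin (by linarith) hy2
  have hsq : ‖2 * Real.sin ((k : ℝ) * P⁻¹ / 2)‖ ^ 2 = 4 * Real.sin y ^ 2 := by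
    have : Real.sin y ^ 2 = Real.sin ((k : ℝ) * P⁻¹ / 2) ^ 2 := by
      rw [hy]
      rcases abs_choice ((k : ℝ) * P⁻¹ / 2) with h | h <;> rw [h]
      rw [Real.sin_neg, neg_sq]
    rw [this, Real.norm_eq_abs, sq_abs]; ring
  rw [hsq]
  have h3 : 1 / (2 * π) ≤ Real.sin y := by
    refine le_trans ?_ hs
    rw [div_mul_eq_mul_div, div_le_div_iff₀ (by positivity) pi_pos]
    nlinarith [pi_pos]
  have h4 : 4 * (1 / (2 * π)) ^ 2 ≤ 4 * Real.sin y ^ 2 := by gcongr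
  have h5 : 1 / 10 ≤ 4 * (1 / (2 * π)) ^ 2 := by
    have := pi_lt_d2
    have := pi_pos
    rw [div_pow, mul_pow, ← mul_div_assoc, div_le_div_iff₀ (by norm_num) (by positivity)]
    nlinarith
  nlinarith

lemma sum_dyadic_shift_le (k : ℤ) (n : ℕ) :
    ∑ j ∈ Finset.range n,
      2 ^ j * ‖fourier k (((2 ^ j)⁻¹ : ℝ) : AddCircle (2 * π)) + (-1)‖ ^ 2 ≤ 10 * |(k : ℝ)| := by
  rcases eq_or_ne k 0 with rfl | hk
  · simp
  obtain ⟨J, h1, h2⟩ := exists_two_pow_le_abs_lt hk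
  set a : ℕ → ℝ := fun j =>
    2 ^ j * ‖fourier k (((2 ^ j)⁻¹ : ℝ) : AddCircle (2 * π)) + (-1)‖ ^ 2 with ha
  have ha0 : ∀ j, 0 ≤ a j := fun j => by positivity
  have ha1 : ∀ j, a j ≤ 4 * 2 ^ j := by
    intro j
    have : ‖fourier k (((2 ^ j)⁻¹ : ℝ) : AddCircle (2 * π)) + (-1)‖ ≤ 2 := by
      refine (norm_add_le _ _).trans ?_
      rw [fourier_apply, Circle.norm_coe]
      norm_num
    calc a j ≤ 2 ^ j * 2 ^ 2 := by simp only [ha]; gcongr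
      _ = 4 * 2 ^ j := by ring
  have ha2 : ∀ j, a j ≤ (k : ℝ) ^ 2 * (2 ^ j)⁻¹ := by
    intro j
    have : ‖fourier k (((2 ^ j)⁻¹ : ℝ) : AddCircle (2 * π)) + (-1)‖ ≤ |(k : ℝ)| * (2 ^ j)⁻¹ := by
      rw [fourier_coe_two_pi, ← sub_eq_add_neg]
      refine norm_exp_I_mul_ofReal_sub_one_le.trans ?_
      rw [Real.norm_eq_abs, abs_mul, abs_of_pos (a := ((2 : ℝ) ^ j)⁻¹) (by positivity)]
    calc a j ≤ 2 ^ j * (|(k : ℝ)| * (2 ^ j)⁻¹) ^ 2 := by simp only [ha]; gcongr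
      _ = (k : ℝ) ^ 2 * (2 ^ j)⁻¹ := by
        rw [mul_pow, sq_abs]; field_simp
  have hlow : ∀ m, ∑ j ∈ Finset.range m, a j ≤ 4 * 2 ^ m := by
    intro m
    induction m with
    | zero => simp
    | succ m ih =>
      rw [Finset.sum_range_succ, pow_succ]
      linarith [ha1 m]
  have hhigh : ∀ m, ∑ j ∈ Finset.range (J + 1 + m), a j ≤
      4 * 2 ^ (J + 1) + (k : ℝ) ^ 2 * ((2 ^ J)⁻¹ - (2 ^ (J + m))⁻¹) := by
    intro m
    induction m with
    | zero => simpa using hlow (J + 1)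
    | succ m ih =>
      rw [← add_assoc, Finset.sum_range_succ]
      have h := ha2 (J + 1 + m)
      have e : ((2 : ℝ) ^ (J + m))⁻¹ = 2 * (2 ^ (J + 1 + m))⁻¹ := by
        rw [show J + 1 + m = (J + m) + 1 by ring, pow_succ]; field_simp
      rw [e] at ih
      rw [show J + (m + 1) = J + 1 + m by ring]
      linarith
  have hmono : ∑ j ∈ Finset.range n, a j ≤ ∑ j ∈ Finset.range (J + 1 + n), a j :=
    Finset.sum_le_sum_of_subset_of_nonneg (Finset.range_mono (by omega)) fun j _ _ => ha0 j
  refine hmono.trans ((hhigh n).trans ?_)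
  have h3 : (k : ℝ) ^ 2 * (2 ^ J)⁻¹ ≤ 2 * |(k : ℝ)| := by
    rw [← div_eq_mul_inv, div_le_iff₀ (by positivity), ← sq_abs]
    rw [pow_succ] at h2
    nlinarith [abs_nonneg (k : ℝ)]
  have h4 : 0 ≤ (k : ℝ) ^ 2 * (2 ^ (J + n))⁻¹ := by positivity
  rw [pow_succ]
  linarith

lemma tsum_dyadic_shift_le (k : ℤ) :
    ∑' j : ℕ, ENNReal.ofReal
      (2 ^ j * ‖fourier k (((2 ^ j)⁻¹ : ℝ) : AddCircle (2 * π)) + (-1)‖ ^ 2) ≤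
      ENNReal.ofReal (10 * |(k : ℝ)|) := by
  rw [ENNReal.tsum_eq_iSup_nat]
  refine iSup_le fun n => ?_
  rw [← ENNReal.ofReal_sum_of_nonneg fun j _ => by positivity]
  exact ENNReal.ofReal_le_ofReal (sum_dyadic_shift_le k n)

/-- The squared `W_2^{1/2}` seminorm, as an extended nonnegative real. -/
def sobolevHalfEnergy (g : AddCircle (2 * π) → ℂ) : ENNReal :=
  ∑' k : ℤ, ENNReal.ofReal (‖fourierCoeff g k‖ ^ 2 * |(k : ℝ)|)

/-- A dyadic sum of squared `L²` moduli of continuity, equivalent to `sobolevHalfEnergy`. -/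
def dyadicEnergy (g : AddCircle (2 * π) → ℂ) : ENNReal :=
  ∑' j : ℕ, ENNReal.ofReal (2 ^ j *
    ∫ x, ‖g (x + (((2 ^ j)⁻¹ : ℝ) : AddCircle (2 * π))) + (-1) * g x‖ ^ 2 ∂haarAddCircle)

lemma dyadicEnergy_eq (g : C(AddCircle (2 * π), ℂ)) :
    dyadicEnergy g = ∑' k : ℤ, ∑' j : ℕ, ENNReal.ofReal (‖fourierCoeff g k‖ ^ 2) *
      ENNReal.ofReal
        (2 ^ j * ‖fourier k (((2 ^ j)⁻¹ : ℝ) : AddCircle (2 * π)) + (-1)‖ ^ 2) := by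
  rw [ENNReal.tsum_comm, dyadicEnergy]
  congr 1
  funext j
  have h := (hasSum_sq_fourierCoeff_shift_add g
    (((2 ^ j)⁻¹ : ℝ) : AddCircle (2 * π)) (-1)).mul_left (2 ^ j)
  rw [← h.tsum_eq, ENNReal.ofReal_tsum_of_nonneg (fun n => by positivity) h.summable]
  congr 1
  funext k
  rw [← ENNReal.ofReal_mul (by positivity)]
  congr 1
  ring

lemma dyadicEnergy_le (g : C(AddCircle (2 * π), ℂ)) :
    dyadicEnergy g ≤ 10 * sobolevHalfEnergy g := by
  rw [dyadicEnergy_eq, sobolevHalfEnergy, ← ENNReal.tsum_mul_left]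
  refine ENNReal.tsum_le_tsum fun k => ?_
  rw [ENNReal.tsum_mul_left]
  refine (mul_le_mul_right (tsum_dyadic_shift_le k) _).trans_eq ?_
  rw [← ENNReal.ofReal_mul (by positivity), ← ENNReal.ofReal_ofNat,
    ← ENNReal.ofReal_mul (by positivity)]
  congr 1
  ring

lemma sobolevHalfEnergy_le (g : C(AddCircle (2 * π), ℂ)) :
    sobolevHalfEnergy g ≤ 10 * dyadicEnergy g := by
  rw [dyadicEnergy_eq, sobolevHalfEnergy, ← ENNReal.tsum_mul_left]
  refine ENNReal.tsum_le_tsum fun k => ?_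
  rcases eq_or_ne k 0 with rfl | hk
  · simp
  obtain ⟨j, hj⟩ := abs_le_dyadic_shift hk
  refine le_trans ?_ (mul_le_mul_right (ENNReal.le_tsum j) _)
  rw [← ENNReal.ofReal_mul (by positivity), ← ENNReal.ofReal_ofNat,
    ← ENNReal.ofReal_mul (by positivity)]
  refine ENNReal.ofReal_le_ofReal ?_
  rw [mul_left_comm]
  gcongr

lemma dyadicEnergy_mono (g G : C(AddCircle (2 * π), ℂ))
    (hG : ∀ x y, ‖G x - G y‖ ≤ 2 * ‖g x - g y‖) :
    dyadicEnergy G ≤ 4 * dyadicEnergy g := by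
  rw [dyadicEnergy, dyadicEnergy, ← ENNReal.tsum_mul_left]
  refine ENNReal.tsum_le_tsum fun j => ?_
  rw [← ENNReal.ofReal_ofNat, ← ENNReal.ofReal_mul (by positivity), mul_left_comm,
    ← integral_const_mul (4 : ℝ)]
  refine ENNReal.ofReal_le_ofReal ?_
  refine mul_le_mul_of_nonneg_left ?_ (by positivity)
  refine integral_mono ?_ ?_ fun x => ?_
  · exact Continuous.integrable_of_hasCompactSupport (by fun_prop)
      (HasCompactSupport.of_compactSpace _)
  · exact Continuous.integrable_of_hasCompactSupport (by fun_prop)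
      (HasCompactSupport.of_compactSpace _)
  · simp only [neg_one_mul, ← sub_eq_add_neg]
    calc _ ≤ (2 * ‖g (x + _) - g x‖) ^ 2 := by gcongr; exact hG _ _
      _ = _ := by ring

/-- The symplectic form of a Lipschitz superposition is controlled by the `W_2^{1/2}` seminorm. -/
lemma abs_integral_im_shift_le (g G : C(AddCircle (2 * π), ℂ))
    (hG : ∀ x y, ‖G x - G y‖ ≤ 2 * ‖g x - g y‖)
    (hg : Summable fun k : ℤ => ‖fourierCoeff g k‖ ^ 2 * |(k : ℝ)|) (t : ℝ) :
    |∫ x, ((starRingEnd ℂ) (G x) * G (x + (t : AddCircle (2 * π)))).im ∂haarAddCircle| ≤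
      |t| * (400 * ∑' k : ℤ, ‖fourierCoeff g k‖ ^ 2 * |(k : ℝ)|) := by
  have hE : sobolevHalfEnergy G ≤
      ENNReal.ofReal (400 * ∑' k : ℤ, ‖fourierCoeff g k‖ ^ 2 * |(k : ℝ)|) := by
    rw [ENNReal.ofReal_mul (by norm_num),
      ENNReal.ofReal_tsum_of_nonneg (fun n => by positivity) hg]
    change _ ≤ _ * sobolevHalfEnergy g
    calc sobolevHalfEnergy G ≤ 10 * dyadicEnergy G := sobolevHalfEnergy_le G
      _ ≤ 10 * (4 * dyadicEnergy g) := by gcongr; exact dyadicEnergy_mono g G hG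
      _ ≤ 10 * (4 * (10 * sobolevHalfEnergy g)) := by gcongr; exact dyadicEnergy_le g
      _ = ENNReal.ofReal 400 * sobolevHalfEnergy g := by
        rw [← mul_assoc, ← mul_assoc, ENNReal.ofReal_ofNat]; norm_num
  have hsum : Summable fun k : ℤ => ‖fourierCoeff G k‖ ^ 2 * |(k : ℝ)| := by
    have := ENNReal.summable_toReal (ne_top_of_le_ne_top ENNReal.ofReal_ne_top hE)
    refine this.congr fun k => ENNReal.toReal_ofReal (by positivity)
  have hle : ∑' k : ℤ, ‖fourierCoeff G k‖ ^ 2 * |(k : ℝ)| ≤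
      400 * ∑' k : ℤ, ‖fourierCoeff g k‖ ^ 2 * |(k : ℝ)| := by
    rw [sobolevHalfEnergy, ← ENNReal.ofReal_tsum_of_nonneg (fun n => by positivity) hsum] at hE
    exact (ENNReal.ofReal_le_ofReal_iff
      (mul_nonneg (by norm_num) (tsum_nonneg fun n => by positivity))).1 hE
  refine le_trans ?_ (mul_le_mul_of_nonneg_left hle (abs_nonneg t))
  have h := hasSum_sq_fourierCoeff_im G (t : AddCircle (2 * π))
  rw [← h.tsum_eq, ← tsum_mul_left, ← Real.norm_eq_abs]
  refine tsum_of_norm_bounded (hsum.mul_left |t|).hasSum fun k => ?_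
  rw [norm_mul, Real.norm_of_nonneg (by positivity), mul_left_comm]
  gcongr
  rw [fourier_coe_two_pi, mul_comm Complex.I, Complex.exp_ofReal_mul_I_im, Real.norm_eq_abs]
  refine Real.abs_sin_le_abs.trans ?_
  rw [abs_mul, mul_comm]

end SobolevHalf

section Lift

lemma AddCircle.exists_continuous_lift {T : ℝ} [Fact (0 < T)] (f : C(ℝ, AddCircle T)) :
    ∃ F : C(ℝ, ℝ), ∀ u, (F u : AddCircle T) = f u := by
  obtain ⟨e, he⟩ := QuotientAddGroup.mk_surjective (f 0)
  obtain ⟨F, ⟨-, hF⟩, -⟩ :=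
    (AddCircle.isCoveringMap_coe T).existsUnique_continuousMap_lifts f 0 e he
  exact ⟨F, fun u => congrFun hF u⟩

/-- After possibly reversing the orientation of the parameter, a circle homeomorphism lifts to a
continuous strictly increasing function on the line. -/
lemma AddCircle.exists_strictMono_lift {T : ℝ} [hT : Fact (0 < T)]
    (h : AddCircle T ≃ₜ AddCircle T) :
    ∃ σ : ℝ, (σ = 1 ∨ σ = -1) ∧ ∃ H : ℝ → ℝ, Continuous H ∧ StrictMono H ∧
      ∀ u : ℝ, (H u : AddCircle T) = h ((σ * u : ℝ) : AddCircle T) := by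
  obtain ⟨H, hH⟩ := AddCircle.exists_continuous_lift
    (ContinuousMap.mk (fun u : ℝ => h (u : AddCircle T))
      (h.continuous.comp (AddCircle.continuous_mk' T)))
  obtain ⟨K, hK⟩ := AddCircle.exists_continuous_lift
    (ContinuousMap.mk (fun u : ℝ => h.symm (u : AddCircle T))
      (h.symm.continuous.comp (AddCircle.continuous_mk' T)))
  simp only [ContinuousMap.coe_mk] at hH hK
  have hKH (u : ℝ) : (K (H u) : AddCircle T) = u := by rw [hK, hH, h.symm_apply_apply]
  have hcomp : (fun u => K (H u)) = fun u => u + K (H 0) := by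
    refine (AddCircle.isCoveringMap_coe T).eq_of_comp_eq (by fun_prop) (by fun_prop) ?_ 0
      (by simp)
    funext u
    simp only [Function.comp_apply, hKH, AddCircle.coe_add, AddCircle.coe_zero, add_zero]
  have hinj : Function.Injective H := fun u v huv => by
    have hu := congrFun hcomp u
    have hv := congrFun hcomp v
    simp only [huv] at hu hv
    linarith
  rcases H.continuous.strictMono_of_inj hinj with hm | hm
  · exact ⟨1, Or.inl rfl, H, H.continuous, hm, fun u => by rw [hH, one_mul]⟩
  · exact ⟨-1, Or.inr rfl, fun u => H (-u), by fun_prop, fun u v huv => hm (neg_lt_neg huv),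
      fun u => by rw [hH, neg_one_mul]⟩

lemma AddCircle.exists_int_of_coe_eq {T a b : ℝ} (hab : (a : AddCircle T) = b) :
    ∃ n : ℤ, a = b + n * T := by
  rw [← sub_eq_zero, ← AddCircle.coe_sub, AddCircle.coe_eq_zero_iff] at hab
  obtain ⟨n, hn⟩ := hab
  exact ⟨n, by rw [zsmul_eq_mul] at hn; linarith⟩

/-- A circle homeomorphism maps a fine enough equidistributed sample, run through twice, to the
projection of a monotone fine sample of an interval of length at least two periods. -/
lemma AddCircle.exists_monotone_sample {T : ℝ} [hT : Fact (0 < T)]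
    (h : AddCircle T ≃ₜ AddCircle T) {ε : ℝ} (hε : 0 < ε) :
    ∃ (t : ℝ) (M : ℕ), M * |t| = T ∧ ∀ x : AddCircle T, ∃ v : ℕ → ℝ,
      (∀ j : ℕ, (v j : AddCircle T) = h (x + j • (t : AddCircle T))) ∧
      (∀ j < 2 * M, v j ≤ v (j + 1) ∧ v (j + 1) - v j ≤ ε) ∧ v 0 + 2 * T ≤ v (2 * M) := by
  have hTpos := hT.out
  obtain ⟨σ, hσ, H, hHc, hHm, hH⟩ := AddCircle.exists_strictMono_lift h
  have hper (r : ℝ) : H r + T ≤ H (r + T) := by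
    have : (H (r + T) : AddCircle T) = H r := by
      rw [hH, hH]
      rcases hσ with rfl | rfl <;> simp [AddCircle.coe_period]
    obtain ⟨n, hn⟩ := AddCircle.exists_int_of_coe_eq this
    have hlt : H r < H (r + T) := hHm (by linarith)
    have hnT : 0 < (n : ℝ) * T := by linarith
    have hn1 : (1 : ℝ) ≤ n := by
      have : (0 : ℝ) < n := pos_of_mul_pos_left hnT hTpos.le
      exact_mod_cast Int.add_one_le_iff.2 (Int.cast_pos.1 this)
    nlinarith
  have huc := isCompact_Icc.uniformContinuousOn_of_continuous
    (hHc.continuousOn (s := Set.Icc 0 (3 * T)))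
  rw [Metric.uniformContinuousOn_iff] at huc
  obtain ⟨η, hη, hη'⟩ := huc ε hε
  obtain ⟨M, hM⟩ := exists_nat_gt (T / η)
  have hMpos : (0 : ℝ) < M := lt_of_le_of_lt (by positivity) hM
  set s : ℝ := T / M with hs
  have hspos : 0 < s := by positivity
  have hsη : s < η := by
    rw [hs, div_lt_iff₀ hMpos]; rw [div_lt_iff₀ hη] at hM; linarith
  have hMs : M * s = T := by rw [hs]; field_simp
  have hσabs : |σ| = 1 := by rcases hσ with rfl | rfl <;> simp
  refine ⟨σ * s, M, by rw [abs_mul, hσabs, one_mul, abs_of_pos hspos, hMs], fun x => ?_⟩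
  obtain ⟨u, ⟨hu0, huT⟩, hux⟩ : ∃ u ∈ Set.Ico (0 : ℝ) T, ((σ * u : ℝ) : AddCircle T) = x := by
    have hsurj (z : AddCircle T) : ∃ u ∈ Set.Ico (0 : ℝ) T, (u : AddCircle T) = z := by
      have := AddCircle.coe_image_Ico_eq T (0 : ℝ)
      have hz : z ∈ ((↑) : ℝ → AddCircle T) '' Set.Ico 0 (0 + T) := by rw [this]; trivial
      simpa using hz
    rcases hσ with rfl | rfl
    · simpa using hsurj x
    · obtain ⟨u, hu, hux⟩ := hsurj (-x)
      exact ⟨u, hu, by rw [neg_one_mul, AddCircle.coe_neg, hux, neg_neg]⟩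
  refine ⟨fun j => H (u + j * s), fun j => ?_, fun j hj => ?_, ?_⟩
  · rw [hH, ← hux, ← AddCircle.coe_nsmul, ← AddCircle.coe_add, nsmul_eq_mul]
    congr 2
    ring
  · have hj' : ((j + 1 : ℕ) : ℝ) * s ≤ 2 * T := by
      have : ((j + 1 : ℕ) : ℝ) ≤ 2 * M := by exact_mod_cast hj
      nlinarith
    push_cast at hj' ⊢
    have hj0 : 0 ≤ (j : ℝ) * s := by positivity
    refine ⟨hHm.monotone (by linarith), ?_⟩
    have := hη' (u + (j + 1) * s) ⟨by linarith, by linarith⟩ (u + j * s)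
      ⟨by linarith, by linarith⟩ (by
        rw [Real.dist_eq, show u + (j + 1) * s - (u + j * s) = s by ring, abs_of_pos hspos]
        exact hsη)
    rw [Real.dist_eq] at this
    exact (le_abs_self _).trans this.le
  · have h1 := hper u
    have h2 := hper (u + T)
    have e : u + ((2 * M : ℕ) : ℝ) * s = u + T + T := by push_cast; linarith
    simp only [e, Nat.cast_zero, zero_mul, add_zero]
    linarith

end Lift

section Polygon

open AddCircle

/-- Lower bound for the sum of the signed areas along a monotone sample, given a lower bound for
each edge in terms of the increment of a clamp function. -/
lemma le_sum_im_of_clamp_le {T : ℝ} [hT : Fact (0 < T)] {F : AddCircle T → ℂ}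
    {c ε α β : ℝ} (hαβ : α ≤ β) (hβ : β ≤ α + T)
    (hF : ∀ y y' : ℝ, y ≤ y' → y' - y ≤ ε →
      c * (max α (min β y') - max α (min β y)) ≤ ((starRingEnd ℂ) (F y) * F y').im)
    {v : ℕ → ℝ} {n : ℕ} (hv : ∀ j < n, v j ≤ v (j + 1) ∧ v (j + 1) - v j ≤ ε)
    (hvn : v 0 + 2 * T ≤ v n) :
    c * (β - α) ≤ ∑ j ∈ Finset.range n, ((starRingEnd ℂ) (F (v j)) * F (v (j + 1))).im := by
  have hTpos := hT.out
  set k : ℤ := ⌊(v 0 - α) / T⌋ + 1 with hk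
  have h1 : (k - 1 : ℝ) * T ≤ v 0 - α := by
    rw [← le_div_iff₀ hTpos, hk]; push_cast; rw [add_sub_cancel_right]; exact Int.floor_le _
  have h2 : v 0 - α ≤ k * T := by
    rw [← div_le_iff₀ hTpos, hk]; push_cast; exact (Int.lt_floor_add_one _).le
  set w : ℕ → ℝ := fun j => v j - k * T with hw
  have hcoe (j : ℕ) : (w j : AddCircle T) = v j := by
    rw [hw, AddCircle.coe_sub, ← zsmul_eq_mul, AddCircle.coe_zsmul, AddCircle.coe_period,
      smul_zero, sub_zero]
  have hterm : ∀ j ∈ Finset.range n,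
      c * max α (min β (w (j + 1))) - c * max α (min β (w j)) ≤
        ((starRingEnd ℂ) (F (v j)) * F (v (j + 1))).im := by
    intro j hj
    obtain ⟨ha, hb⟩ := hv j (Finset.mem_range.1 hj)
    rw [← hcoe, ← hcoe, ← mul_sub]
    exact hF _ _ (by simp only [hw]; linarith) (by simp only [hw]; linarith)
  refine le_trans ?_ (Finset.sum_le_sum hterm)
  rw [Finset.sum_range_sub (fun j => c * max α (min β (w j)))]
  have h0 : max α (min β (w 0)) = α :=
    max_eq_left ((min_le_right _ _).trans (by simp only [hw]; linarith))
  have hn : max α (min β (w n)) = β := by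
    rw [min_eq_left (by simp only [hw]; linarith), max_eq_right hαβ]
  rw [h0, hn, mul_sub]

/-- A lower bound for the `W_2^{1/2}` seminorm of `f ∘ h`, uniform in the homeomorphism `h`. -/
lemma le_tsum_fourierCoeff_comp_homeomorph (f F : C(AddCircle (2 * π), ℂ))
    (hfF : ∀ x y, ‖F x - F y‖ ≤ 2 * ‖f x - f y‖)
    {c ε α β : ℝ} (hε : 0 < ε) (hαβ : α ≤ β) (hβ : β ≤ α + 2 * π)
    (hF : ∀ y y' : ℝ, y ≤ y' → y' - y ≤ ε →
      c * (max α (min β y') - max α (min β y)) ≤ ((starRingEnd ℂ) (F y) * F y').im)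
    (h : AddCircle (2 * π) ≃ₜ AddCircle (2 * π))
    (hs : Summable fun k : ℤ => ‖fourierCoeff (f ∘ h) k‖ ^ 2 * |(k : ℝ)|) :
    c * (β - α) ≤ 1600 * π * ∑' k : ℤ, ‖fourierCoeff (f ∘ h) k‖ ^ 2 * |(k : ℝ)| := by
  obtain ⟨t, M, hMt, hsample⟩ := AddCircle.exists_monotone_sample h hε
  set g : C(AddCircle (2 * π), ℂ) := f.comp (h : C(_, _)) with hg
  set G : C(AddCircle (2 * π), ℂ) := F.comp (h : C(_, _)) with hG
  have hbound := abs_integral_im_shift_le g G (fun x y => hfF _ _) hs t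
  set τ : AddCircle (2 * π) := (t : AddCircle (2 * π)) with hτ
  set Q : AddCircle (2 * π) → ℝ := fun x => ((starRingEnd ℂ) (G x) * G (x + τ)).im with hQ
  have hQc : Continuous Q := by fun_prop
  have hint (y : AddCircle (2 * π)) : Integrable (fun x => Q (x + y)) haarAddCircle :=
    Continuous.integrable_of_hasCompactSupport (by fun_prop) (HasCompactSupport.of_compactSpace _)
  have hpoint (x : AddCircle (2 * π)) :
      c * (β - α) ≤ ∑ j ∈ Finset.range (2 * M), Q (x + j • τ) := by
    obtain ⟨v, hvx, hv, hvM⟩ := hsample x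
    refine (le_sum_im_of_clamp_le hαβ hβ hF hv hvM).trans_eq (Finset.sum_congr rfl fun j _ => ?_)
    rw [hvx, hvx, succ_nsmul, ← add_assoc]
    rfl
  have havg : c * (β - α) ≤ (2 * M : ℕ) * ∫ x, Q x ∂haarAddCircle := by
    have h1 : ∫ _x : AddCircle (2 * π), c * (β - α) ∂haarAddCircle ≤
        ∫ x, ∑ j ∈ Finset.range (2 * M), Q (x + j • τ) ∂haarAddCircle :=
      integral_mono (integrable_const _) (integrable_finsetSum _ fun j _ => hint _) hpoint
    rw [integral_const, probReal_univ, one_smul,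
      integral_finsetSum _ fun j _ => hint _] at h1
    simp_rw [integral_add_right_eq_self Q] at h1
    simpa using h1
  calc c * (β - α) ≤ (2 * M : ℕ) * ∫ x, Q x ∂haarAddCircle := havg
    _ ≤ (2 * M : ℕ) * (|t| * (400 * ∑' k : ℤ, ‖fourierCoeff g k‖ ^ 2 * |(k : ℝ)|)) := by
      gcongr; exact (le_abs_self _).trans hbound
    _ = 2 * (M * |t|) * 400 * ∑' k : ℤ, ‖fourierCoeff g k‖ ^ 2 * |(k : ℝ)| := by
      push_cast; ring
    _ = 1600 * π * ∑' k : ℤ, ‖fourierCoeff g k‖ ^ 2 * |(k : ℝ)| := by rw [hMt]; ring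

end Polygon

section Modulus

variable {ω : ℝ → ℝ}

lemma IsModulusOfContinuity.abs_sub_le (hω : IsModulusOfContinuity ω) {a b : ℝ} (ha : 0 ≤ a)
    (hb : 0 ≤ b) : |ω a - ω b| ≤ ω |a - b| := by
  obtain ⟨-, hmono, -, -, hadd⟩ := hω
  have key : ∀ {x y : ℝ}, 0 ≤ x → x ≤ y → |ω x - ω y| ≤ ω |x - y| := by
    intro x y hx hxy
    have h1 : ω x ≤ ω y := hmono hx (hx.trans hxy) hxy
    have h2 := hadd x (y - x) hx (sub_nonneg.2 hxy)
    rw [add_sub_cancel] at h2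
    rw [abs_sub_comm, abs_sub_comm x, abs_of_nonneg (sub_nonneg.2 h1),
      abs_of_nonneg (sub_nonneg.2 hxy)]
    linarith
  rcases le_total a b with h | h
  · exact key ha h
  · rw [abs_sub_comm, abs_sub_comm a]
    exact key hb h

lemma IsModulusOfContinuity.nat_mul_le (hω : IsModulusOfContinuity ω) {d : ℝ} (hd : 0 ≤ d)
    (n : ℕ) : ω (n * d) ≤ n * ω d := by
  obtain ⟨-, -, h0, -, hadd⟩ := hω
  induction n with
  | zero => simp [h0]
  | succ n ih =>
    push_cast
    rw [add_mul, add_mul, one_mul, one_mul]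
    exact (hadd _ _ (by positivity) hd).trans (by linarith)

lemma IsModulusOfContinuity.mul_min_le (hω : IsModulusOfContinuity ω) {d δ : ℝ} (hd : 0 ≤ d)
    (hδ : 0 < δ) : ω δ * min 2 (d / δ) ≤ 2 * ω d := by
  have hpos := hω.2.2.2.1
  have hmono := hω.2.1
  rcases le_total δ d with h | h
  · calc ω δ * min 2 (d / δ) ≤ ω d * 2 := by
          gcongr
          · exact hpos d hd
          · exact hmono hδ.le hd h
          · exact min_le_left _ _
      _ = 2 * ω d := mul_comm _ _
  · rcases hd.eq_or_lt with rfl | hd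
    · simpa using hpos 0 le_rfl
    have h1 : δ ≤ ⌈δ / d⌉₊ * d := by
      rw [← div_le_iff₀ hd]; exact Nat.le_ceil _
    have h2 : (⌈δ / d⌉₊ : ℝ) ≤ 2 * (δ / d) := by
      have h3 := Nat.ceil_lt_add_one (a := δ / d) (by positivity)
      have h4 : 1 ≤ δ / d := by rwa [one_le_div hd]
      linarith
    have h3 : ω δ ≤ 2 * (δ / d) * ω d :=
      (hmono hδ.le (hδ.le.trans h1) h1).trans ((hω.nat_mul_le hd.le _).trans
        (mul_le_mul_of_nonneg_right h2 (hpos d hd.le)))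
    calc ω δ * min 2 (d / δ) ≤ 2 * (δ / d) * ω d * (d / δ) := by
          gcongr
          · have := hpos d hd.le; positivity
          · exact min_le_right _ _
      _ = 2 * ω d := by field_simp

lemma IsModulusOfContinuity.exists_pos_lt (hω : IsModulusOfContinuity ω) {r : ℝ} (hr : 0 < r) :
    ∃ η > 0, ∀ d, 0 ≤ d → d < η → ω d < r := by
  obtain ⟨hcont, -, h0, hpos, -⟩ := hω
  obtain ⟨η, hη, H⟩ := Metric.continuousOn_iff.1 hcont 0 (Set.mem_Ici.2 le_rfl) r hr
  refine ⟨η, hη, fun d hd hdη => ?_⟩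
  have := H d hd (by rwa [Real.dist_0_eq_abs, abs_of_nonneg hd])
  rw [h0, Real.dist_0_eq_abs] at this
  exact (le_abs_self _).trans_lt this

end Modulus

section Truncation

variable {E : Type*} [NormedAddCommGroup E] [NormedSpace ℝ E]

/-- Radial soft thresholding: shrinks the norm by `ρ`, sending the ball of radius `ρ` to `0`. -/
def softThreshold (ρ : ℝ) (z : E) : E := max 0 (1 - ρ / ‖z‖) • z

lemma softThreshold_smul {ρ a : ℝ} (hρ : 0 ≤ ρ) (ha : 0 ≤ a) {e : E} (he : ‖e‖ = 1) :
    softThreshold ρ (a • e) = max 0 (a - ρ) • e := by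
  rw [softThreshold, norm_smul, he, mul_one, Real.norm_of_nonneg ha, smul_smul]
  congr 1
  rcases ha.eq_or_lt with rfl | ha
  · simp [hρ]
  · rw [max_mul_of_nonneg _ _ ha.le, zero_mul, sub_mul, div_mul_cancel₀ _ ha.ne', one_mul]

lemma norm_softThreshold_sub_le {ρ : ℝ} (hρ : 0 ≤ ρ) (z w : E) :
    ‖softThreshold ρ z - softThreshold ρ w‖ ≤ 2 * ‖z - w‖ := by
  wlog h : ‖w‖ ≤ ‖z‖ generalizing z w
  · rw [norm_sub_rev, norm_sub_rev z]
    exact this w z (le_of_not_ge h)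
  have hs (x : E) : max 0 (1 - ρ / ‖x‖) * ‖x‖ = max 0 (‖x‖ - ρ) := by
    rcases (norm_nonneg x).eq_or_lt with hx | hx
    · simp [← hx, hρ]
    · rw [max_mul_of_nonneg _ _ hx.le, zero_mul, sub_mul, div_mul_cancel₀ _ hx.ne', one_mul]
  have hs1 (x : E) : max 0 (1 - ρ / ‖x‖) ≤ 1 :=
    max_le zero_le_one (sub_le_self _ (by positivity))
  rcases (norm_nonneg w).eq_or_lt with hw | hw
  · have hw0 : w = 0 := norm_eq_zero.1 hw.symm
    subst hw0
    have : softThreshold ρ (0 : E) = 0 := by simp [softThreshold]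
    rw [this, sub_zero, sub_zero, softThreshold, norm_smul,
      Real.norm_of_nonneg (le_max_left _ _)]
    gcongr
    linarith [hs1 z]
  have hz : 0 < ‖z‖ := hw.trans_le h
  set a := max 0 (1 - ρ / ‖z‖) with ha
  set b := max 0 (1 - ρ / ‖w‖) with hb
  have hba : b ≤ a := by rw [ha, hb]; gcongr
  have hb0 : 0 ≤ b := le_max_left _ _
  have hsplit : softThreshold ρ z - softThreshold ρ w = b • (z - w) + (a - b) • z := by
    rw [softThreshold, softThreshold, ← ha, ← hb, smul_sub, sub_smul]; abel
  have h1 : a * ‖z‖ - b * ‖w‖ ≤ ‖z - w‖ := by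
    rw [ha, hb, hs, hs]
    refine le_trans ?_ (norm_sub_norm_le z w)
    rcases le_total (‖z‖ - ρ) 0 with hz' | hz'
    · rw [max_eq_left hz']
      linarith [le_max_left 0 (‖w‖ - ρ)]
    · rw [max_eq_right hz']
      linarith [le_max_right 0 (‖w‖ - ρ)]
  have h2 : b * ‖w‖ ≤ b * ‖z‖ := by gcongr
  have h3 : b * ‖z - w‖ ≤ 1 * ‖z - w‖ := by gcongr; exact hs1 w
  rw [hsplit]
  refine (norm_add_le _ _).trans ?_
  rw [norm_smul, norm_smul, Real.norm_of_nonneg hb0, Real.norm_of_nonneg (sub_nonneg.2 hba)]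
  linarith

end Truncation

section Construction

open AddCircle

lemma AddCircle.exists_coe_eq_abs_eq_norm {T : ℝ} (x : AddCircle T) :
    ∃ r : ℝ, (r : AddCircle T) = x ∧ |r| = ‖x‖ := by
  obtain ⟨a, rfl⟩ := QuotientAddGroup.mk_surjective x
  refine ⟨a - round (T⁻¹ * a) * T, ?_, (AddCircle.norm_eq (p := T)).symm⟩
  rw [AddCircle.coe_sub, ← zsmul_eq_mul, AddCircle.coe_zsmul, AddCircle.coe_period,
      smul_zero, sub_zero]

lemma norm_fourier_sub_le (m : ℕ) (t s : AddCircle (2 * π)) :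
    ‖fourier (m : ℤ) t - fourier (m : ℤ) s‖ ≤ min 2 (m * dist t s) := by
  refine le_min ?_ ?_
  · refine (norm_sub_le _ _).trans ?_
    rw [fourier_apply, fourier_apply, Circle.norm_coe, Circle.norm_coe]
    norm_num
  · obtain ⟨r, hr, hr'⟩ := AddCircle.exists_coe_eq_abs_eq_norm (t - s)
    have h : fourier (m : ℤ) t = fourier (m : ℤ) s * fourier (m : ℤ) (r : AddCircle (2 * π)) := by
      rw [hr, fourier_apply, fourier_apply, fourier_apply, ← Circle.coe_mul,
        ← AddCircle.toCircle_add, ← smul_add, add_sub_cancel]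
    rw [h, ← mul_sub_one, norm_mul, fourier_apply (x := s), Circle.norm_coe, one_mul,
      fourier_coe_two_pi, dist_eq_norm, ← hr']
    refine norm_exp_I_mul_ofReal_sub_one_le.trans ?_
    rw [Real.norm_eq_abs, abs_mul]
    simp

lemma im_conj_smul_fourier_mul (a b : ℝ) (m : ℕ) (y z : ℝ) :
    ((starRingEnd ℂ) (a • fourier (m : ℤ) (y : AddCircle (2 * π))) *
      (b • fourier (m : ℤ) (z : AddCircle (2 * π)))).im = a * b * Real.sin (m * (z - y)) := by
  rw [fourier_coe_two_pi, fourier_coe_two_pi, mul_comm Complex.I, mul_comm Complex.I, mul_sub,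
    Real.sin_sub]
  simp only [Complex.real_smul, map_mul, Complex.conj_ofReal, Complex.mul_im, Complex.mul_re,
    Complex.conj_re, Complex.conj_im, Complex.ofReal_re, Complex.ofReal_im,
    Complex.exp_ofReal_mul_I_re, Complex.exp_ofReal_mul_I_im, Int.cast_natCast]
  ring

/-- The distance from `t` to the complement of the arc of radius `2⁻ⁿ / 4` around `2⁻ⁿ`,
cut off at `1 / m n`. -/
def arcDepth (m : ℕ → ℕ) (n : ℕ) (t : AddCircle (2 * π)) : ℝ :=
  max 0 (min (1 / (m n : ℝ)) ((1 / 2) ^ n / 4 - dist t (((1 / 2 : ℝ) ^ n : ℝ) : AddCircle (2 * π))))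

/-- A loop winding with speed `m n`, supported on the arc of radius `2⁻ⁿ / 4` around `2⁻ⁿ`. -/
def arcLoop (ω : ℝ → ℝ) (m : ℕ → ℕ) (n : ℕ) (t : AddCircle (2 * π)) : ℂ :=
  ω (arcDepth m n t) • fourier (m n : ℤ) t

/-- The superposition of all the loops `arcLoop ω m n`. -/
def arcLoops (ω : ℝ → ℝ) (m : ℕ → ℕ) (t : AddCircle (2 * π)) : ℂ :=
  ∑' n, arcLoop ω m n t

variable {ω : ℝ → ℝ} {m : ℕ → ℕ}

lemma arcDepth_nonneg (m : ℕ → ℕ) (n : ℕ) (t : AddCircle (2 * π)) : 0 ≤ arcDepth m n t :=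
  le_max_left _ _

lemma arcDepth_le (m : ℕ → ℕ) (n : ℕ) (t : AddCircle (2 * π)) : arcDepth m n t ≤ 1 / m n :=
  max_le (by positivity) (min_le_left _ _)

lemma abs_arcDepth_sub_le (m : ℕ → ℕ) (n : ℕ) (t s : AddCircle (2 * π)) :
    |arcDepth m n t - arcDepth m n s| ≤ dist t s := by
  have h : ∀ t s : AddCircle (2 * π), arcDepth m n t ≤ arcDepth m n s + dist t s := by
    intro t s
    have h1 := dist_triangle_left s (((1 / 2 : ℝ) ^ n : ℝ) : AddCircle (2 * π)) t
    have h2 := dist_nonneg (x := t) (y := s)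
    rw [arcDepth, arcDepth, max_add, min_add]
    refine max_le_max (by linarith) (min_le_min (by linarith) (by linarith))
  rw [abs_sub_le_iff]
  exact ⟨by linarith [h t s], by linarith [h s t, dist_comm s t]⟩

lemma dist_lt_of_arcDepth_ne_zero {n : ℕ} {t : AddCircle (2 * π)} (h : arcDepth m n t ≠ 0) :
    dist t (((1 / 2 : ℝ) ^ n : ℝ) : AddCircle (2 * π)) < (1 / 2) ^ n / 4 := by
  by_contra! hle
  exact h (max_eq_left ((min_le_right _ _).trans (by linarith)))

lemma dist_coe_two_pi_of_le {a b : ℝ} (hab : |a - b| ≤ 1) :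
    dist (a : AddCircle (2 * π)) b = |a - b| := by
  rw [dist_eq_norm, ← AddCircle.coe_sub, AddCircle.norm_coe_eq_abs_iff _ (by positivity),
    abs_of_pos two_pi_pos]
  linarith [pi_gt_three]

lemma arcDepth_eq_zero_of_ne {n k : ℕ} (hnk : n ≠ k) {t : AddCircle (2 * π)}
    (hn : arcDepth m n t ≠ 0) : arcDepth m k t = 0 := by
  by_contra hk
  wlog h : n < k generalizing n k
  · exact this hnk.symm hk hn (lt_of_le_of_ne (not_lt.1 h) hnk.symm)
  have h1 := dist_lt_of_arcDepth_ne_zero hn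
  have h2 := dist_lt_of_arcDepth_ne_zero hk
  have h3 := dist_triangle_left (((1 / 2 : ℝ) ^ n : ℝ) : AddCircle (2 * π))
    (((1 / 2 : ℝ) ^ k : ℝ) : AddCircle (2 * π)) t
  have h4 : (1 / 2 : ℝ) ^ k ≤ (1 / 2) ^ n / 2 := by
    calc (1 / 2 : ℝ) ^ k ≤ (1 / 2) ^ (n + 1) :=
          pow_le_pow_of_le_one (by norm_num) (by norm_num) h
      _ = (1 / 2) ^ n / 2 := by rw [pow_succ]; ring
  have h5 : (1 / 2 : ℝ) ^ n ≤ 1 := pow_le_one₀ (by norm_num) (by norm_num)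
  have h6 : 0 < (1 / 2 : ℝ) ^ k := by positivity
  have h7 : |(1 / 2 : ℝ) ^ n - (1 / 2) ^ k| = (1 / 2) ^ n - (1 / 2) ^ k :=
    abs_of_nonneg (by linarith)
  rw [dist_coe_two_pi_of_le (by rw [h7]; linarith), h7] at h3
  linarith

lemma arcDepth_eq_of_dist_le {n : ℕ} (hm : 1 / (m n : ℝ) ≤ (1 / 2) ^ n / 8)
    {t : AddCircle (2 * π)}
    (ht : dist t (((1 / 2 : ℝ) ^ n : ℝ) : AddCircle (2 * π)) ≤ (1 / 2) ^ n / 8) :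
    arcDepth m n t = 1 / m n := by
  rw [arcDepth, min_eq_left (by linarith), max_eq_right (by positivity)]

lemma norm_arcLoop_sub_le (hω : IsModulusOfContinuity ω) {n : ℕ} (hm : 0 < m n)
    (t s : AddCircle (2 * π)) : ‖arcLoop ω m n t - arcLoop ω m n s‖ ≤ 3 * ω (dist t s) := by
  have hmono := hω.2.1
  have hpos := hω.2.2.2.1
  have hm' : (0 : ℝ) < m n := by exact_mod_cast hm
  have hsplit : arcLoop ω m n t - arcLoop ω m n s =
      (ω (arcDepth m n t) - ω (arcDepth m n s)) • fourier (m n : ℤ) t +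
      ω (arcDepth m n s) • (fourier (m n : ℤ) t - fourier (m n : ℤ) s) := by
    rw [arcLoop, arcLoop, sub_smul, smul_sub]; abel
  have h1 : |ω (arcDepth m n t) - ω (arcDepth m n s)| ≤ ω (dist t s) :=
    (hω.abs_sub_le (arcDepth_nonneg _ _ _) (arcDepth_nonneg _ _ _)).trans
      (hmono (Set.mem_Ici.2 (abs_nonneg _)) (Set.mem_Ici.2 dist_nonneg)
        (abs_arcDepth_sub_le m n t s))
  have h2 : ω (arcDepth m n s) * ‖fourier (m n : ℤ) t - fourier (m n : ℤ) s‖ ≤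
      2 * ω (dist t s) := by
    refine le_trans ?_ (hω.mul_min_le dist_nonneg (one_div_pos.2 hm'))
    rw [div_div_eq_mul_div, div_one, mul_comm (dist t s)]
    gcongr
    · exact hpos _ (by positivity)
    · exact hmono (Set.mem_Ici.2 (arcDepth_nonneg _ _ _)) (Set.mem_Ici.2 (one_div_pos.2 hm').le)
        (arcDepth_le m n s)
    · exact norm_fourier_sub_le (m n) t s
  rw [hsplit]
  refine (norm_add_le _ _).trans ?_
  rw [norm_smul, norm_smul, fourier_apply (x := t), Circle.norm_coe, mul_one, Real.norm_eq_abs,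
    Real.norm_of_nonneg (hpos _ (arcDepth_nonneg _ _ _)), ← fourier_apply]
  linarith

lemma exists_arcLoops_eq (hω : IsModulusOfContinuity ω) (m : ℕ → ℕ) (t : AddCircle (2 * π)) :
    ∃ n, arcLoops ω m t = arcLoop ω m n t ∧ ∀ k, k ≠ n → arcDepth m k t = 0 := by
  obtain ⟨n, hn⟩ : ∃ n, ∀ k, k ≠ n → arcDepth m k t = 0 := by
    by_cases h : ∃ n, arcDepth m n t ≠ 0
    · obtain ⟨n, hn⟩ := h
      exact ⟨n, fun k hk => arcDepth_eq_zero_of_ne hk.symm hn⟩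
    · push Not at h
      exact ⟨0, fun k _ => h k⟩
  refine ⟨n, tsum_eq_single n fun k hk => ?_, hn⟩
  rw [arcLoop, hn k hk, hω.2.2.1, zero_smul]

lemma norm_arcLoops_sub_le (hω : IsModulusOfContinuity ω) (hm : ∀ n, 0 < m n)
    (t s : AddCircle (2 * π)) : ‖arcLoops ω m t - arcLoops ω m s‖ ≤ 6 * ω (dist t s) := by
  obtain ⟨n, hn, hn'⟩ := exists_arcLoops_eq hω m t
  obtain ⟨k, hk, hk'⟩ := exists_arcLoops_eq hω m s
  have hpos := hω.2.2.2.1 (dist t s) dist_nonneg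
  have hzero {j : ℕ} {x : AddCircle (2 * π)} (h : arcDepth m j x = 0) : arcLoop ω m j x = 0 := by
    rw [arcLoop, h, hω.2.2.1, zero_smul]
  rw [hn, hk]
  rcases eq_or_ne n k with rfl | hnk
  · exact (norm_arcLoop_sub_le hω (hm n) t s).trans (by linarith)
  · have h1 := norm_arcLoop_sub_le hω (hm n) t s
    have h2 := norm_arcLoop_sub_le hω (hm k) t s
    rw [hzero (hk' n hnk), sub_zero] at h1
    rw [hzero (hn' k hnk.symm), zero_sub, norm_neg] at h2
    exact (norm_sub_le _ _).trans (by linarith)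

lemma continuous_arcLoops (hω : IsModulusOfContinuity ω) (hm : ∀ n, 0 < m n) :
    Continuous (arcLoops ω m) := by
  rw [Metric.continuous_iff]
  intro s r hr
  obtain ⟨η, hη, H⟩ := hω.exists_pos_lt (r := r / 6) (by positivity)
  refine ⟨η, hη, fun t ht => ?_⟩
  rw [dist_eq_norm]
  have := H _ dist_nonneg ht
  linarith [norm_arcLoops_sub_le hω hm t s]

end Construction

section Estimate

variable {ω : ℝ → ℝ} {m : ℕ → ℕ}

lemma exists_frequency (hω : IsModulusOfContinuity ω)
    (hlimsup : ∀ M : ℝ, ∃ᶠ δ in nhdsWithin 0 (Set.Ioi 0), M < ω δ / √δ) (N : ℕ) :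
    ∃ m : ℕ, 0 < m ∧ 1 / (m : ℝ) ≤ (1 / 2) ^ N / 8 ∧ 4 ^ N ≤ ω (1 / m) ^ 2 * m := by
  have hη : (0 : ℝ) < (1 / 2) ^ N / 16 := by positivity
  have hη1 : (1 / 2 : ℝ) ^ N ≤ 1 := pow_le_one₀ (by norm_num) (by norm_num)
  obtain ⟨δ, hMδ, hδ, hδη⟩ :=
    ((hlimsup (2 * 2 ^ N)).and_eventually (Ioo_mem_nhdsGT hη)).exists
  have hinv : 1 ≤ 1 / δ := by rw [one_le_div hδ]; linarith
  have hm1 : 1 ≤ ⌊1 / δ⌋₊ := (Nat.one_le_floor_iff _).2 hinv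
  have hm2 : (⌊1 / δ⌋₊ : ℝ) ≤ 1 / δ := Nat.floor_le (by positivity)
  have hm3 := Nat.lt_floor_add_one (1 / δ)
  generalize ⌊1 / δ⌋₊ = m at hm1 hm2 hm3
  have hm1' : (1 : ℝ) ≤ m := by exact_mod_cast hm1
  have hm0 : (0 : ℝ) < m := by linarith
  have h1 : δ ≤ 1 / m := by rwa [le_div_iff₀ hm0, mul_comm, ← le_div_iff₀ hδ]
  have h2 : 1 ≤ 2 * (m * δ) := by
    have : 1 / δ ≤ 2 * m := by linarith
    rw [div_le_iff₀ hδ] at this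
    linarith
  refine ⟨m, hm1, ?_, ?_⟩
  · rw [div_le_iff₀ hm0]
    nlinarith
  · have h3 : 2 * 2 ^ N * √δ ≤ ω (1 / m) :=
      ((lt_div_iff₀ (Real.sqrt_pos.2 hδ)).1 hMδ).le.trans
        (hω.2.1 (Set.mem_Ici.2 hδ.le) (Set.mem_Ici.2 (by positivity)) h1)
    have h4 : (4 : ℝ) ^ N = (2 ^ N) ^ 2 := by rw [← pow_mul, mul_comm N, pow_mul]; norm_num
    calc (4 : ℝ) ^ N ≤ 4 ^ N * (2 * (2 * (m * δ))) := by
          nlinarith [pow_pos (zero_lt_four' ℝ) N]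
      _ = (2 * 2 ^ N * √δ) ^ 2 * m := by
          rw [mul_pow, mul_pow, Real.sq_sqrt hδ.le, h4]; ring
      _ ≤ ω (1 / m) ^ 2 * m := by gcongr

lemma norm_fourier_apply (n : ℤ) (t : AddCircle (2 * π)) : ‖fourier n t‖ = 1 := by
  rw [fourier_apply, Circle.norm_coe]

lemma softThreshold_arcLoop (hω : IsModulusOfContinuity ω) {ρ : ℝ} (hρ : 0 ≤ ρ) (n : ℕ)
    (t : AddCircle (2 * π)) : softThreshold ρ (arcLoop ω m n t) =
      max 0 (ω (arcDepth m n t) - ρ) • fourier (m n : ℤ) t :=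
  softThreshold_smul hρ (hω.2.2.2.1 _ (arcDepth_nonneg _ _ _)) (norm_fourier_apply _ _)

lemma exists_le_im_conj_softThreshold_arcLoops (hω : IsModulusOfContinuity ω) (hm : ∀ n, 0 < m n)
    (hm' : ∀ n, 1 / (m n : ℝ) ≤ (1 / 2) ^ n / 8) {N : ℕ} {ρ : ℝ} (hρ : 0 < ρ)
    (hN : ω (1 / m N) = 2 * ρ) :
    ∃ ε > 0, ∀ y y' : ℝ, y ≤ y' → y' - y ≤ ε →
      (ρ / 2) ^ 2 * (2 / π) * m N *
        (max ((1 / 2) ^ N) (min ((1 / 2) ^ N + (1 / 2) ^ N / 8) y') -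
          max ((1 / 2) ^ N) (min ((1 / 2) ^ N + (1 / 2) ^ N / 8) y)) ≤
      ((starRingEnd ℂ) (softThreshold ρ (arcLoops ω m y)) *
        softThreshold ρ (arcLoops ω m y')).im := by
  have hmono := hω.2.1
  have hpos := hω.2.2.2.1
  have hmpos : ∀ n, (0 : ℝ) < m n := fun n => by exact_mod_cast hm n
  obtain ⟨η, hη, Hη⟩ := hω.exists_pos_lt hρ
  obtain ⟨K, hK⟩ := exists_pow_lt_of_lt_one hη (by norm_num : (1 / 2 : ℝ) < 1)
  have hlarge : ∀ n, K ≤ n → ω (1 / m n) < ρ := fun n hn => by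
    refine Hη _ (one_div_pos.2 (hmpos n)).le ((hm' n).trans_lt ?_)
    have h1 : (1 / 2 : ℝ) ^ n ≤ (1 / 2) ^ K :=
      pow_le_pow_of_le_one (by norm_num) (by norm_num) hn
    have h2 : (0 : ℝ) < (1 / 2) ^ n := by positivity
    linarith
  have hsmall : ∀ {n : ℕ} {t : AddCircle (2 * π)}, ρ < ω (arcDepth m n t) → n < K := by
    intro n t h
    by_contra! hn
    exact absurd (h.trans_le (hmono (Set.mem_Ici.2 (arcDepth_nonneg _ _ _))
      (Set.mem_Ici.2 (one_div_pos.2 (hmpos n)).le) (arcDepth_le m n t))) (hlarge n hn).not_gt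
  obtain ⟨η', hη', Hη'⟩ := hω.exists_pos_lt (half_pos hρ)
  obtain ⟨M, hM⟩ : ∃ M : ℝ, ∀ n < K, (m n : ℝ) ≤ M :=
    ⟨∑ n ∈ Finset.range K, (m n : ℝ), fun n hn =>
      Finset.single_le_sum (f := fun n => (m n : ℝ)) (fun i _ => (hmpos i).le)
        (Finset.mem_range.2 hn)⟩
  set ε := min (η' / 2) (π / 2 / (|M| + 1)) with hε
  have hε0 : 0 < ε := by positivity
  refine ⟨ε, hε0, fun y y' hyy hyε => ?_⟩
  have hangle : ∀ n < K, m n * (y' - y) ≤ π / 2 := fun n hn => by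
    calc m n * (y' - y) ≤ (|M| + 1) * (π / 2 / (|M| + 1)) := by
          refine mul_le_mul ((hM n hn).trans (by linarith [le_abs_self M]))
            (hyε.trans (min_le_right _ _)) (by linarith) (by positivity)
      _ = π / 2 := by field_simp
  have hd : ∀ a b : ℝ, |a - b| ≤ ε → ω (dist (a : AddCircle (2 * π)) b) < ρ / 2 := fun a b h => by
    refine Hη' _ dist_nonneg ?_
    have h1 : dist (a : AddCircle (2 * π)) b ≤ |a - b| := by
      rw [dist_eq_norm, ← AddCircle.coe_sub]
      exact QuotientAddGroup.norm_mk_le_norm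
    have h2 : ε ≤ η' / 2 := min_le_left _ _
    linarith
  have hamp : ∀ n (a b : ℝ), |a - b| ≤ ε →
      |ω (arcDepth m n a) - ω (arcDepth m n b)| < ρ / 2 := fun n a b h =>
    ((hω.abs_sub_le (arcDepth_nonneg _ _ _) (arcDepth_nonneg _ _ _)).trans
      (hmono (Set.mem_Ici.2 (abs_nonneg _)) (Set.mem_Ici.2 dist_nonneg)
        (abs_arcDepth_sub_le m n a b))).trans_lt (hd a b h)
  have hyy' : |y - y'| ≤ ε := by rwa [abs_sub_comm, abs_of_nonneg (by linarith)]
  obtain ⟨n, hn, hn'⟩ := exists_arcLoops_eq hω m (y : AddCircle (2 * π))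
  obtain ⟨k, hk, hk'⟩ := exists_arcLoops_eq hω m (y' : AddCircle (2 * π))
  rw [hn, hk, softThreshold_arcLoop hω hρ.le, softThreshold_arcLoop hω hρ.le]
  rcases (max_le_max (le_refl ((1 / 2 : ℝ) ^ N)) (min_le_min
    (le_refl ((1 / 2 : ℝ) ^ N + (1 / 2) ^ N / 8)) hyy)).eq_or_lt with hcl | hcl
  · rw [hcl, sub_self, mul_zero]
    rcases le_or_gt (ω (arcDepth m n y)) ρ with h | h
    · rw [max_eq_left (sub_nonpos.2 h), zero_smul, map_zero, zero_mul, Complex.zero_im]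
    rcases le_or_gt (ω (arcDepth m k y')) ρ with h' | h'
    · rw [max_eq_left (sub_nonpos.2 h'), zero_smul, mul_zero, Complex.zero_im]
    have hnk : n = k := by
      by_contra hnk
      have h1 := hamp n y y' hyy'
      rw [hk' n hnk, hω.2.2.1, sub_zero] at h1
      linarith [le_abs_self (ω (arcDepth m n y))]
    subst hnk
    rw [im_conj_smul_fourier_mul]
    have := hangle n (hsmall h)
    have := mul_nonneg (hmpos n).le (sub_nonneg.2 hyy)
    have := Real.sin_nonneg_of_nonneg_of_le_pi this (by linarith [pi_pos])
    positivity
  · have hA : (0 : ℝ) < (1 / 2) ^ N := by positivity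
    have hA1 : (1 / 2 : ℝ) ^ N ≤ 1 := pow_le_one₀ (by norm_num) (by norm_num)
    set A := (1 / 2 : ℝ) ^ N with hAdef
    set z := max A (min (A + A / 8) y) with hz
    set z' := max A (min (A + A / 8) y') with hz'
    have hzA : A ≤ z ∧ z ≤ A + A / 8 :=
      ⟨le_max_left _ _, max_le (by linarith) (min_le_left _ _)⟩
    have hy1 : y < A + A / 8 := by
      by_contra! h
      rw [hz, hz', min_eq_left h, min_eq_left (h.trans hyy)] at hcl
      exact lt_irrefl _ hcl
    have hy2 : A < y' := by
      by_contra! h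
      rw [hz, hz', max_eq_left ((min_le_right _ _).trans h),
        max_eq_left ((min_le_right _ _).trans (hyy.trans h))] at hcl
      exact lt_irrefl _ hcl
    have hzy : y ≤ z ∧ z ≤ y' ∧ z' - z ≤ y' - y := by
      rw [hz, hz', min_eq_right hy1.le, max_eq_right (le_min (by linarith) hy2.le)]
      refine ⟨le_max_right _ _, max_le hy2.le hyy, ?_⟩
      have := min_le_right (A + A / 8) y'
      have := le_max_right A y
      linarith
    have hzN : ω (arcDepth m N z) = 2 * ρ := by
      rw [arcDepth_eq_of_dist_le (hm' N), hN]
      rw [← hAdef, dist_coe_two_pi_of_le] <;> rw [abs_of_nonneg (by linarith)] <;> linarith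
    have hN1 := hamp N y z (by rw [abs_le]; constructor <;> linarith)
    have hN2 := hamp N y' z (by rw [abs_le]; constructor <;> linarith)
    rw [hzN, abs_lt] at hN1 hN2
    have hidx : N = n := by
      by_contra h
      rw [hn' N h, hω.2.2.1] at hN1
      linarith
    have hidx' : N = k := by
      by_contra h
      rw [hk' N h, hω.2.2.1] at hN2
      linarith
    rw [← hidx, ← hidx', im_conj_smul_fourier_mul]
    have hsin := Real.mul_le_sin (x := m N * (y' - y))
      (mul_nonneg (hmpos N).le (sub_nonneg.2 hyy)) (hangle N (hsmall (t := y) (by linarith)))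
    have hm1 : ρ / 2 ≤ max 0 (ω (arcDepth m N y) - ρ) := le_max_of_le_right (by linarith)
    have hm2 : ρ / 2 ≤ max 0 (ω (arcDepth m N y') - ρ) := le_max_of_le_right (by linarith)
    calc (ρ / 2) ^ 2 * (2 / π) * m N * (z' - z)
        ≤ (ρ / 2) ^ 2 * (2 / π) * m N * (y' - y) :=
          mul_le_mul_of_nonneg_left hzy.2.2 (by positivity)
      _ = (ρ / 2 * (ρ / 2)) * (2 / π * (m N * (y' - y))) := by ring
      _ ≤ _ := by
          have := mul_nonneg (hmpos N).le (sub_nonneg.2 hyy)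
          gcongr

lemma mul_le_tsum_fourierCoeff_arcLoops_comp (hω : IsModulusOfContinuity ω) (hm : ∀ n, 0 < m n)
    (hm' : ∀ n, 1 / (m n : ℝ) ≤ (1 / 2) ^ n / 8) {N : ℕ} (hN : 0 < ω (1 / m N))
    (h : AddCircle (2 * π) ≃ₜ AddCircle (2 * π))
    (hs : Summable fun k : ℤ => ‖fourierCoeff (arcLoops ω m ∘ h) k‖ ^ 2 * |(k : ℝ)|) :
    ω (1 / m N) ^ 2 * m N * (1 / 2) ^ N ≤
      64 * π * (1600 * π * ∑' k : ℤ, ‖fourierCoeff (arcLoops ω m ∘ h) k‖ ^ 2 * |(k : ℝ)|) := by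
  have hcont := continuous_arcLoops hω hm
  have hρ : 0 < ω (1 / m N) / 2 := half_pos hN
  obtain ⟨ε, hε, H⟩ := exists_le_im_conj_softThreshold_arcLoops hω hm hm' hρ (N := N) (by ring)
  have hthr : Continuous (softThreshold (E := ℂ) (ω (1 / m N) / 2)) :=
    (LipschitzWith.of_dist_le_mul (K := 2) fun z w => by
      simpa only [dist_eq_norm, NNReal.coe_ofNat] using
        norm_softThreshold_sub_le hρ.le z w).continuous
  have hA : (1 / 2 : ℝ) ^ N ≤ 1 := pow_le_one₀ (by norm_num) (by norm_num)
  have hA0 : (0 : ℝ) < (1 / 2) ^ N := by positivity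
  have key := le_tsum_fourierCoeff_comp_homeomorph ⟨_, hcont⟩ ⟨_, hthr.comp hcont⟩
    (fun x y => norm_softThreshold_sub_le hρ.le _ _) hε
    (by linarith) (by linarith [pi_gt_three]) H h hs
  rw [ContinuousMap.coe_mk] at key
  refine le_trans (le_of_eq ?_) (mul_le_mul_of_nonneg_left key (by positivity : 0 ≤ 64 * π))
  field_simp
  ring

end Estimate

/-- Suppose `ω` is a modulus of continuity with `limsup_{δ→0+} ω(δ)/√δ = ∞`. Then there
exists a complex-valued `f ∈ Lip_ω(𝕋)` such that for every homeomorphism `h` of the circle,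
`f ∘ h ∉ W_2^{1/2}(𝕋)`, i.e. `∑_{k∈ℤ} |widehat{f∘h}(k)|²|k| = ∞`. -/
theorem bohrPal_LipOmega_not_W_half (ω : ℝ → ℝ) (hω : IsModulusOfContinuity ω)
    (hlimsup : ∀ M : ℝ, ∃ᶠ δ in nhdsWithin 0 (Set.Ioi 0), M < ω δ / Real.sqrt δ) :
    ∃ f : AddCircle (2 * Real.pi) → ℂ,
      (∃ C : ℝ, ∀ t₁ t₂ : AddCircle (2 * Real.pi), ‖f t₁ - f t₂‖ ≤ C * ω (dist t₁ t₂)) ∧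
      ∀ h : AddCircle (2 * Real.pi) ≃ₜ AddCircle (2 * Real.pi),
        ¬ Summable (fun k : ℤ => ‖fourierCoeff (f ∘ h) k‖ ^ 2 * |(k : ℝ)|) := by
  choose m hm hm' hm4 using exists_frequency hω hlimsup
  refine ⟨arcLoops ω m, ⟨6, norm_arcLoops_sub_le hω hm⟩, fun h hs => ?_⟩
  obtain ⟨N, hN⟩ := pow_unbounded_of_one_lt
    (64 * π * (1600 * π * ∑' k : ℤ, ‖fourierCoeff (arcLoops ω m ∘ h) k‖ ^ 2 * |(k : ℝ)|))
    one_lt_two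
  have hpos : 0 < ω (1 / m N) := by
    refine lt_of_le_of_ne (hω.2.2.2.1 _ (by positivity)) fun h0 => ?_
    have := hm4 N
    rw [← h0] at this
    have : (0 : ℝ) < 4 ^ N := by positivity
    linarith
  refine hN.not_ge (le_trans ?_ (mul_le_tsum_fourierCoeff_arcLoops_comp hω hm hm' hpos h hs))
  calc (2 : ℝ) ^ N = 4 ^ N * (1 / 2) ^ N := by rw [← mul_pow]; norm_num
    _ ≤ ω (1 / m N) ^ 2 * m N * (1 / 2) ^ N := by gcongr; exact hm4 N
end
end

section
/- For every α with 0 < α < 1/2 there exists a complex-valued function f ∈ Lip_α(𝕋) such that for every homeomorphism h of the circle 𝕋 onto itself, f∘h does not belong to W_2^{1/2}(𝕋). -/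
open Real MeasureTheory Filter

noncomputable section

open AddCircle in
/-- Parseval's identity for `x ↦ g (x + δ) - a * g x`. -/
theorem hasSum_sq_fourierCoeff_translate_sub {T : ℝ} [Fact (0 < T)] {g : AddCircle T → ℂ}
    (hg : Continuous g) (δ : AddCircle T) (a : ℂ) :
    HasSum (fun k : ℤ => ‖fourier k δ - a‖ ^ 2 * ‖fourierCoeff g k‖ ^ 2)
      (∫ x, ‖g (x + δ) - a * g x‖ ^ 2 ∂haarAddCircle) := by
  have hG : Continuous fun x => g (x + δ) - a * g x := by fun_prop
  let G : C(AddCircle T, ℂ) := ⟨_, hG⟩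
  have hint : ∀ {u : AddCircle T → ℂ}, Continuous u → Integrable u haarAddCircle := fun hu =>
    hu.integrable_of_hasCompactSupport (HasCompactSupport.of_compactSpace _)
  have htrans : ∀ k : ℤ, fourierCoeff (fun x => g (x + δ)) k = fourier k δ * fourierCoeff g k := by
    intro k
    unfold fourierCoeff
    rw [← integral_add_right_eq_self (μ := haarAddCircle)
      (fun x => fourier (-k) x • g x) δ, ← integral_const_mul]
    congr 1 with x
    have h1 : fourier k δ * fourier (-k) δ = (1 : ℂ) := by
      have := fourier_add (m := k) (n := -k) (x := δ)
      simpa using this.symm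
    have h2 : fourier (-k) (x + δ) = fourier (-k) x * fourier (-k) δ := by
      simp [fourier_apply, toCircle_add]
    rw [smul_eq_mul, smul_eq_mul, h2]
    linear_combination (-(fourier (-k) x * g (x + δ))) * h1
  have hcoeff : ∀ k : ℤ, fourierCoeff G k = (fourier k δ - a) * fourierCoeff g k := by
    intro k
    have : (G : AddCircle T → ℂ) = (fun x => g (x + δ)) + fun x => (-a) * g x := by
      ext x; simp [G, sub_eq_add_neg]
    rw [this, fourierCoeff.add (hint (by fun_prop)) (hint (by fun_prop)), Pi.add_apply, htrans,
      fourierCoeff.const_mul]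
    ring
  have h := hasSum_sq_fourierCoeff (ContinuousMap.toLp (E := ℂ) 2 haarAddCircle ℂ G)
  have hI : ∫ t, ‖(ContinuousMap.toLp (E := ℂ) 2 haarAddCircle ℂ G) t‖ ^ 2 ∂haarAddCircle
      = ∫ x, ‖g (x + δ) - a * g x‖ ^ 2 ∂haarAddCircle := by
    refine integral_congr_ae ?_
    filter_upwards [ContinuousMap.coeFn_toLp (E := ℂ) (p := 2) haarAddCircle (𝕜 := ℂ) G] with x hx
    rw [hx]; rfl
  rw [hI] at h
  refine h.congr_fun ?_
  intro k
  rw [fourierCoeff_toLp, hcoeff, norm_mul, mul_pow]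

theorem fourier_two_pi_coe (k : ℤ) (δ : ℝ) :
    fourier k (δ : AddCircle (2 * π)) = Complex.exp ((k * δ : ℝ) * Complex.I) := by
  rw [fourier_coe_apply]
  congr 1
  have : (π : ℂ) ≠ 0 := by exact_mod_cast Real.pi_ne_zero
  push_cast
  field_simp

theorem norm_exp_mul_I_sub_one_sq (t : ℝ) :
    ‖Complex.exp (t * Complex.I) - 1‖ ^ 2 = 2 - 2 * Real.cos t := by
  rw [Complex.exp_mul_I, ← Complex.ofReal_cos, ← Complex.ofReal_sin, ← Complex.normSq_eq_norm_sq,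
    Complex.normSq_apply]
  simp only [Complex.add_re, Complex.sub_re, Complex.add_im, Complex.sub_im, Complex.mul_re,
    Complex.mul_im, Complex.ofReal_re, Complex.ofReal_im, Complex.I_re, Complex.I_im,
    Complex.one_re, Complex.one_im]
  nlinarith [Real.sin_sq_add_cos_sq t]

theorem norm_exp_mul_I_sub_I_sq (t : ℝ) :
    ‖Complex.exp (t * Complex.I) - Complex.I‖ ^ 2 = 2 - 2 * Real.sin t := by
  rw [Complex.exp_mul_I, ← Complex.ofReal_cos, ← Complex.ofReal_sin, ← Complex.normSq_eq_norm_sq,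
    Complex.normSq_apply]
  simp only [Complex.add_re, Complex.sub_re, Complex.add_im, Complex.sub_im, Complex.mul_re,
    Complex.mul_im, Complex.ofReal_re, Complex.ofReal_im, Complex.I_re, Complex.I_im]
  nlinarith [Real.sin_sq_add_cos_sq t]

theorem abs_sub_sin_le_one_sub_cos {t : ℝ} (ht : |t| ≤ 1) :
    |t - Real.sin t| ≤ 1 - Real.cos t := by
  have h1 := abs_le.1 (Real.sin_bound ht)
  have h2 := abs_le.1 (Real.cos_bound ht)
  have h4 : |t| ^ 4 = t ^ 4 := by rw [← abs_pow]; exact abs_of_nonneg (by positivity)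
  have h8 : |t| ^ 5 ≤ t ^ 2 := by
    rw [← sq_abs t]
    exact pow_le_pow_of_le_one (abs_nonneg t) ht (by norm_num)
  rw [h4] at h2
  have h3 := abs_le.1 ht
  have h5 : t ^ 4 ≤ t ^ 2 := by
    nlinarith [sq_nonneg t, mul_nonneg (sq_nonneg t) (by nlinarith : 0 ≤ 1 - t ^ 2)]
  have h6 : t ^ 3 ≤ t ^ 2 := by
    nlinarith [sq_nonneg t, mul_nonneg (sq_nonneg t) (by linarith : 0 ≤ 1 - t)]
  have h7 : -t ^ 2 ≤ t ^ 3 := by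
    nlinarith [sq_nonneg t, mul_nonneg (sq_nonneg t) (by linarith : 0 ≤ 1 + t)]
  rw [abs_le]
  constructor <;> nlinarith

/-- A continuous unimodular function of degree `N` on the circle satisfies
`|N| ≤ 2 ∑ |k| |ĝ(k)|²`. -/
theorem abs_degree_le_two_mul_tsum (N : ℤ) (P : C(AddCircle (2 * π), ℝ))
    {g : AddCircle (2 * π) → ℂ}
    (hg : ∀ x, g x = fourier N x * Complex.exp (P x * Complex.I))
    (hs : Summable fun k : ℤ => ‖fourierCoeff g k‖ ^ 2 * |(k : ℝ)|) :
    |(N : ℝ)| ≤ 2 * ∑' k : ℤ, ‖fourierCoeff g k‖ ^ 2 * |(k : ℝ)| := by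
  have hgc : Continuous g := by
    rw [funext hg]; fun_prop
  have hnorm : ∀ x, ‖g x‖ = 1 := fun x => by
    rw [hg, norm_mul, Complex.norm_exp_ofReal_mul_I, fourier_apply, Circle.norm_coe, one_mul]
  obtain ⟨η, hη, hP⟩ := Metric.uniformContinuous_iff.1
    (CompactSpace.uniformContinuous_of_continuous P.continuous) (1 / 2) (by norm_num)
  obtain ⟨δ, hδ0, hδη, hδN⟩ : ∃ δ : ℝ, 0 < δ ∧ δ < η ∧ |(N : ℝ)| * δ ≤ 1 / 2 := by
    refine ⟨min (η / 2) (1 / 2 / (|(N : ℝ)| + 1)), by positivity, ?_, ?_⟩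
    · exact (min_le_left _ _).trans_lt (by linarith)
    · calc |(N : ℝ)| * min (η / 2) (1 / 2 / (|(N : ℝ)| + 1))
          ≤ (|(N : ℝ)| + 1) * (1 / 2 / (|(N : ℝ)| + 1)) := by
            gcongr
            · linarith
            · exact min_le_right _ _
        _ = 1 / 2 := by field_simp
  set d : AddCircle (2 * π) := (δ : AddCircle (2 * π)) with hd
  set t : AddCircle (2 * π) → ℝ := fun x => N * δ + (P (x + d) - P x) with ht
  have htc : Continuous t := by fun_prop
  have ht1 : ∀ x, |t x| ≤ 1 := by
    intro x
    have h1 : dist (x + d) x < η := by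
      rw [dist_eq_norm, add_sub_cancel_left]
      refine lt_of_le_of_lt ?_ hδη
      have := QuotientAddGroup.norm_mk_le_norm (S := AddSubgroup.zmultiples (2 * π)) (m := δ)
      rwa [Real.norm_eq_abs, abs_of_pos hδ0] at this
    have h2 := hP h1
    rw [Real.dist_eq] at h2
    calc |t x| ≤ |(N : ℝ) * δ| + |P (x + d) - P x| := abs_add_le _ _
      _ ≤ 1 := by rw [abs_mul, abs_of_pos hδ0]; linarith
  have hint : ∀ {u : AddCircle (2 * π) → ℝ}, Continuous u → Integrable u AddCircle.haarAddCircle :=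
    fun hu => hu.integrable_of_hasCompactSupport (HasCompactSupport.of_compactSpace _)
  have hmean : ∫ x, t x ∂AddCircle.haarAddCircle = N * δ := by
    simp only [ht]
    rw [integral_add (integrable_const _) (hint (by fun_prop)),
      integral_sub (hint (by fun_prop)) (hint (by fun_prop)),
      integral_add_right_eq_self (μ := AddCircle.haarAddCircle) (fun x => P x) d]
    simp
  have hquot : ∀ x (a : ℂ), ‖g (x + d) - a * g x‖ ^ 2
      = ‖Complex.exp (t x * Complex.I) - a‖ ^ 2 := by
    intro x a
    have : g (x + d) - a * g x = (Complex.exp (t x * Complex.I) - a) * g x := by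
      have h1 : fourier N (x + d) = fourier N x * fourier N d := by
        simp [fourier_apply, AddCircle.toCircle_add]
      have h2 : Complex.exp (P (x + d) * Complex.I) * fourier N d
          = Complex.exp (t x * Complex.I) * Complex.exp (P x * Complex.I) := by
        rw [hd, fourier_two_pi_coe, ← Complex.exp_add, ← Complex.exp_add]
        congr 1
        simp only [ht, hd]
        push_cast
        ring
      rw [hg (x + d), hg x, h1]
      linear_combination (fourier N x) * h2
    rw [this, norm_mul, hnorm, mul_one]
  have hA := hasSum_sq_fourierCoeff_translate_sub hgc d 1
  have hB := hasSum_sq_fourierCoeff_translate_sub hgc d Complex.I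
  have hC := hasSum_sq_fourierCoeff_translate_sub hgc d 0
  simp only [hquot] at hA hB hC
  simp only [hd, fourier_two_pi_coe, norm_exp_mul_I_sub_one_sq, norm_exp_mul_I_sub_I_sq,
    sub_zero, Complex.norm_exp_ofReal_mul_I] at hA hB hC
  have hone : ∫ _x : AddCircle (2 * π), (1 : ℝ) ^ 2 ∂AddCircle.haarAddCircle = 1 := by simp
  rw [hone] at hC
  have hA' : HasSum (fun k : ℤ => (1 - Real.cos (k * δ)) * ‖fourierCoeff g k‖ ^ 2)
      (∫ x, (1 - Real.cos (t x)) ∂AddCircle.haarAddCircle) := by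
    have h := hA.mul_left (1 / 2)
    have e : ∫ x, (1 - Real.cos (t x)) ∂AddCircle.haarAddCircle
        = 1 / 2 * ∫ x, (2 - 2 * Real.cos (t x)) ∂AddCircle.haarAddCircle := by
      rw [← integral_const_mul]; congr 1 with x; ring
    rw [e]
    refine h.congr_fun fun k => by ring
  have hB' : HasSum (fun k : ℤ => Real.sin (k * δ) * ‖fourierCoeff g k‖ ^ 2)
      (∫ x, Real.sin (t x) ∂AddCircle.haarAddCircle) := by
    have h := hC.sub (hB.mul_left (1 / 2))
    have e : ∫ x, Real.sin (t x) ∂AddCircle.haarAddCircle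
        = 1 - 1 / 2 * ∫ x, (2 - 2 * Real.sin (t x)) ∂AddCircle.haarAddCircle := by
      rw [integral_sub (integrable_const _) (hint (by fun_prop)), integral_const_mul]
      simp
      ring
    rw [e]
    refine h.congr_fun fun k => by ring
  set S := ∑' k : ℤ, ‖fourierCoeff g k‖ ^ 2 * |(k : ℝ)| with hS
  have hSs : HasSum (fun k : ℤ => δ * (‖fourierCoeff g k‖ ^ 2 * |(k : ℝ)|)) (δ * S) :=
    hs.hasSum.mul_left δ
  have habs : ∀ k : ℤ, |(k : ℝ) * δ| = |(k : ℝ)| * δ := fun k => by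
    rw [abs_mul, abs_of_pos hδ0]
  have hA1 : ∫ x, (1 - Real.cos (t x)) ∂AddCircle.haarAddCircle ≤ δ * S := by
    refine hasSum_le (fun k => ?_) hA' hSs
    have h1 : 1 - Real.cos (k * δ) ≤ |(k : ℝ)| * δ := by
      rw [← habs]
      rcases le_total |(k : ℝ) * δ| 2 with h | h
      · have := Real.one_sub_sq_div_two_le_cos (x := k * δ)
        nlinarith [sq_abs ((k : ℝ) * δ), abs_nonneg ((k : ℝ) * δ)]
      · linarith [Real.neg_one_le_cos (k * δ)]
    nlinarith [mul_le_mul_of_nonneg_right h1 (sq_nonneg ‖fourierCoeff g k‖)]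
  have hB1 : |∫ x, Real.sin (t x) ∂AddCircle.haarAddCircle| ≤ δ * S := by
    have h1 : ∀ k : ℤ, |Real.sin (k * δ)| ≤ |(k : ℝ)| * δ := fun k =>
      (habs k) ▸ Real.abs_sin_le_abs
    rw [abs_le]
    constructor
    · refine hasSum_le (fun k => ?_) hSs.neg hB'
      nlinarith [mul_le_mul_of_nonneg_right (abs_le.1 (h1 k)).1 (sq_nonneg ‖fourierCoeff g k‖)]
    · refine hasSum_le (fun k => ?_) hB' hSs
      nlinarith [mul_le_mul_of_nonneg_right (abs_le.1 (h1 k)).2 (sq_nonneg ‖fourierCoeff g k‖)]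
  have hdiff : |N * δ - ∫ x, Real.sin (t x) ∂AddCircle.haarAddCircle| ≤ δ * S := by
    rw [← hmean, ← integral_sub (hint htc) (hint (by fun_prop))]
    refine (abs_integral_le_integral_abs).trans (le_trans ?_ hA1)
    exact integral_mono (hint (by fun_prop)) (hint (by fun_prop))
      fun x => abs_sub_sin_le_one_sub_cos (ht1 x)
  have hfin : |(N : ℝ)| * δ ≤ 2 * S * δ := by
    rw [← habs]
    have := abs_sub_abs_le_abs_sub ((N : ℝ) * δ) (∫ x, Real.sin (t x) ∂AddCircle.haarAddCircle)
    linarith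
  exact le_of_mul_le_mul_right hfin hδ0
theorem lintegral_one_sub_cos_mul_div_sq (k : ℤ) :
    ∫⁻ δ : ℝ, ENNReal.ofReal ((2 - 2 * Real.cos (k * δ)) / δ ^ 2)
      = ENNReal.ofReal |(k : ℝ)| * ∫⁻ δ : ℝ, ENNReal.ofReal ((2 - 2 * Real.cos δ) / δ ^ 2) := by
  rcases eq_or_ne k 0 with rfl | hk
  · simp
  have hk' : (k : ℝ) ≠ 0 := by exact_mod_cast hk
  set F : ℝ → ENNReal := fun δ => ENNReal.ofReal ((2 - 2 * Real.cos δ) / δ ^ 2) with hF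
  have hFm : Measurable F := by fun_prop
  have h1 : ∀ δ : ℝ, ENNReal.ofReal ((2 - 2 * Real.cos (k * δ)) / δ ^ 2)
      = ENNReal.ofReal ((k : ℝ) ^ 2) * F (k * δ) := by
    intro δ
    rw [hF, ← ENNReal.ofReal_mul (by positivity)]
    congr 1
    rcases eq_or_ne δ 0 with rfl | hδ
    · simp
    · field_simp
  simp_rw [h1]
  rw [lintegral_const_mul _ (by fun_prop),
    ← lintegral_map (μ := volume) (f := F) (g := fun δ : ℝ => (k : ℝ) * δ) hFm (by fun_prop),
    Real.map_volume_mul_left hk', lintegral_smul_measure, smul_eq_mul, ← mul_assoc,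
    ← ENNReal.ofReal_mul (by positivity)]
  congr 2
  rw [abs_inv, ← sq_abs]
  have : |(k : ℝ)| ≠ 0 := by positivity
  field_simp

theorem lintegral_one_sub_cos_div_sq_ne_top :
    ∫⁻ δ : ℝ, ENNReal.ofReal ((2 - 2 * Real.cos δ) / δ ^ 2) ≠ ⊤ := by
  have hi : Integrable fun δ : ℝ => 5 * (1 + δ ^ 2)⁻¹ := integrable_inv_one_add_sq.const_mul 5
  refine ne_top_of_le_ne_top hi.lintegral_lt_top.ne (lintegral_mono fun δ => ?_)
  refine ENNReal.ofReal_le_ofReal ?_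
  rcases eq_or_ne δ 0 with rfl | hδ
  · simp
  have h1 := Real.one_sub_sq_div_two_le_cos (x := δ)
  have h2 := Real.neg_one_le_cos δ
  rw [← div_eq_mul_inv, div_le_div_iff₀ (by positivity) (by positivity)]
  nlinarith [sq_nonneg δ]

theorem lintegral_one_sub_cos_div_sq_ne_zero :
    ∫⁻ δ : ℝ, ENNReal.ofReal ((2 - 2 * Real.cos δ) / δ ^ 2) ≠ 0 := by
  refine ((lintegral_pos_iff_support (by fun_prop)).2 ?_).ne'
  refine lt_of_lt_of_le ?_ (measure_mono (s := Set.Ioo (0 : ℝ) 1) fun δ hδ => ?_)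
  · simp
  · have h1 : Real.cos δ < 1 := by
      refine lt_of_le_of_ne (Real.cos_le_one δ) fun h => hδ.1.ne' ?_
      exact (Real.cos_eq_one_iff_of_lt_of_lt (by linarith [Real.pi_gt_three, hδ.1])
        (by linarith [Real.pi_gt_three, hδ.2])).1 h
    have h0 := hδ.1
    simp only [Function.mem_support, ne_eq, ENNReal.ofReal_eq_zero, not_le]
    have : 0 < 2 - 2 * Real.cos δ := by linarith
    positivity

/-- The Gagliardo form of the `W_2^{1/2}` seminorm. -/
theorem lintegral_translate_sub_eq {g : AddCircle (2 * π) → ℂ} (hg : Continuous g) :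
    ∫⁻ δ : ℝ, ENNReal.ofReal
        ((∫ x, ‖g (x + (δ : AddCircle (2 * π))) - g x‖ ^ 2 ∂AddCircle.haarAddCircle) / δ ^ 2)
      = (∫⁻ δ : ℝ, ENNReal.ofReal ((2 - 2 * Real.cos δ) / δ ^ 2)) *
        ∑' k : ℤ, ENNReal.ofReal (‖fourierCoeff g k‖ ^ 2 * |(k : ℝ)|) := by
  have h1 : ∀ δ : ℝ, ENNReal.ofReal
        ((∫ x, ‖g (x + (δ : AddCircle (2 * π))) - g x‖ ^ 2 ∂AddCircle.haarAddCircle) / δ ^ 2)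
      = ∑' k : ℤ, ENNReal.ofReal (‖fourierCoeff g k‖ ^ 2) *
          ENNReal.ofReal ((2 - 2 * Real.cos (k * δ)) / δ ^ 2) := by
    intro δ
    have h := (hasSum_sq_fourierCoeff_translate_sub hg (δ : AddCircle (2 * π)) 1).div_const (δ ^ 2)
    simp only [fourier_two_pi_coe, norm_exp_mul_I_sub_one_sq, one_mul] at h
    have hnn : ∀ k : ℤ, 0 ≤ 2 - 2 * Real.cos (k * δ) := fun k => by
      linarith [Real.cos_le_one (k * δ)]
    rw [← h.tsum_eq, ENNReal.ofReal_tsum_of_nonneg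
      (fun k => div_nonneg (mul_nonneg (hnn k) (by positivity)) (by positivity)) h.summable]
    refine tsum_congr fun k => ?_
    rw [← ENNReal.ofReal_mul (by positivity)]
    congr 1
    ring
  simp_rw [h1]
  rw [lintegral_tsum fun k => by fun_prop, ← ENNReal.tsum_mul_left]
  refine tsum_congr fun k => ?_
  rw [lintegral_const_mul _ (by fun_prop), lintegral_one_sub_cos_mul_div_sq, ← mul_assoc,
    ← ENNReal.ofReal_mul (by positivity), mul_comm]

/-- Composition with an `L`-Lipschitz map enlarges the squared `W_2^{1/2}` seminorm at most by the
factor `L ^ 2`. -/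
theorem summable_fourierCoeff_of_norm_sub_le {g u : AddCircle (2 * π) → ℂ} (hg : Continuous g)
    (hu : Continuous u) {L : ℝ} (hL : ∀ x y, ‖u x - u y‖ ≤ L * ‖g x - g y‖)
    (hs : Summable fun k : ℤ => ‖fourierCoeff g k‖ ^ 2 * |(k : ℝ)|) :
    (Summable fun k : ℤ => ‖fourierCoeff u k‖ ^ 2 * |(k : ℝ)|) ∧
      ∑' k : ℤ, ‖fourierCoeff u k‖ ^ 2 * |(k : ℝ)|
        ≤ L ^ 2 * ∑' k : ℤ, ‖fourierCoeff g k‖ ^ 2 * |(k : ℝ)| := by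
  have hint : ∀ {v : AddCircle (2 * π) → ℝ}, Continuous v → Integrable v AddCircle.haarAddCircle :=
    fun hv => hv.integrable_of_hasCompactSupport (HasCompactSupport.of_compactSpace _)
  have hle : ∫⁻ δ : ℝ, ENNReal.ofReal
        ((∫ x, ‖u (x + (δ : AddCircle (2 * π))) - u x‖ ^ 2 ∂AddCircle.haarAddCircle) / δ ^ 2)
      ≤ ENNReal.ofReal (L ^ 2) * ∫⁻ δ : ℝ, ENNReal.ofReal
        ((∫ x, ‖g (x + (δ : AddCircle (2 * π))) - g x‖ ^ 2 ∂AddCircle.haarAddCircle) / δ ^ 2) := by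
    rw [← lintegral_const_mul' _ _ ENNReal.ofReal_ne_top]
    refine lintegral_mono fun δ => ?_
    dsimp only
    rw [← ENNReal.ofReal_mul (by positivity), ← mul_div_assoc, ← integral_const_mul]
    refine ENNReal.ofReal_le_ofReal (div_le_div_of_nonneg_right ?_ (by positivity))
    refine integral_mono (hint (by fun_prop)) (hint (by fun_prop)) fun x => ?_
    dsimp only
    rw [← mul_pow]
    exact pow_le_pow_left₀ (norm_nonneg _) (hL _ _) 2
  rw [lintegral_translate_sub_eq hg, lintegral_translate_sub_eq hu, mul_left_comm,
    ENNReal.mul_le_mul_iff_right lintegral_one_sub_cos_div_sq_ne_zero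
      lintegral_one_sub_cos_div_sq_ne_top,
    ← ENNReal.ofReal_tsum_of_nonneg (fun k => by positivity) hs,
    ← ENNReal.ofReal_mul (by positivity)] at hle
  have hsu : Summable fun k : ℤ => ‖fourierCoeff u k‖ ^ 2 * |(k : ℝ)| := by
    have := ENNReal.summable_toReal (ne_top_of_le_ne_top ENNReal.ofReal_ne_top hle)
    refine this.congr fun k => ENNReal.toReal_ofReal (by positivity)
  refine ⟨hsu, ?_⟩
  rw [← ENNReal.ofReal_tsum_of_nonneg (fun k => by positivity) hsu] at hle
  exact (ENNReal.ofReal_le_ofReal_iff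
    (mul_nonneg (sq_nonneg _) (tsum_nonneg fun k => by positivity))).1 hle
theorem exists_int_mul_eq_of_coe_eq_zero {T : ℝ} (hT : T ≠ 0) {f : ℝ → ℝ} (hf : Continuous f)
    (h0 : ∀ x, (f x : AddCircle T) = 0) : ∃ n : ℤ, ∀ x, f x = n * T := by
  have h1 : ∀ x, ∃ n : ℤ, f x = n * T := fun x => by
    obtain ⟨n, hn⟩ := (AddCircle.coe_eq_zero_iff T).1 (h0 x)
    exact ⟨n, by rw [← hn, zsmul_eq_mul]⟩
  choose n hn using h1
  have hnc : Continuous n := by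
    rw [Int.isClosedEmbedding_coe_real.isEmbedding.continuous_iff]
    have : (fun k : ℤ => (k : ℝ)) ∘ n = fun x => f x / T := by
      ext x
      simp [hn, hT]
    rw [this]
    fun_prop
  exact ⟨n 0, fun x => by
    rw [hn x, PreconnectedSpace.constant inferInstance hnc (x := x) (y := 0)]⟩

theorem exists_continuousMap_coe_eq {T : ℝ} {f : ℝ → ℝ} (hf : Continuous f)
    (hper : Function.Periodic f T) :
    ∃ Q : C(AddCircle T, ℝ), ∀ x : ℝ, Q (x : AddCircle T) = f x :=
  ⟨⟨hper.lift, continuous_coinduced_dom.2 hf⟩, fun x => hper.lift_coe x⟩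

/-- A homeomorphism of the circle has a nonzero degree. -/
theorem exists_degree_homeomorph (h : AddCircle (2 * π) ≃ₜ AddCircle (2 * π)) :
    ∃ d : ℤ, d ≠ 0 ∧ ∃ Q : C(AddCircle (2 * π), ℝ), ∀ (M : ℤ) (x : AddCircle (2 * π)),
      fourier M (h x) = fourier (M * d) x * Complex.exp ((M * Q x : ℝ) * Complex.I) := by
  have hT : (2 * π : ℝ) ≠ 0 := by positivity
  obtain ⟨y, hy⟩ := QuotientAddGroup.mk_surjective (h ((0 : ℝ) : AddCircle (2 * π)))
  obtain ⟨H, ⟨-, hH⟩, -⟩ := (AddCircle.isCoveringMap_coe (2 * π)).existsUnique_continuousMap_lifts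
    ⟨fun x : ℝ => h (x : AddCircle (2 * π)), by fun_prop⟩ 0 y hy
  have hH' : ∀ x : ℝ, (H x : AddCircle (2 * π)) = h x := fun x => congrFun hH x
  obtain ⟨d, hd⟩ := exists_int_mul_eq_of_coe_eq_zero hT
    (f := fun x => H (x + 2 * π) - H x) (by fun_prop) fun x => by
      rw [AddCircle.coe_sub, hH', hH', AddCircle.coe_add_period, sub_self]
  obtain ⟨Q, hQ⟩ := exists_continuousMap_coe_eq (T := 2 * π) (f := fun x => H x - d * x)
    (by fun_prop) fun x => by
      have := hd x
      simp only at this ⊢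
      linarith
  refine ⟨d, ?_, Q, fun M x => ?_⟩
  · rintro rfl
    have hsec : ∀ z : AddCircle (2 * π), (Q (h.symm z) : AddCircle (2 * π)) = z := by
      intro z
      obtain ⟨x, hx⟩ := QuotientAddGroup.mk_surjective (h.symm z)
      have hx' : (x : AddCircle (2 * π)) = h.symm z := hx
      rw [← hx', hQ]
      simp [hH', hx']
    obtain ⟨n, hn⟩ := exists_int_mul_eq_of_coe_eq_zero hT
      (f := fun x : ℝ => Q (h.symm (x : AddCircle (2 * π))) - x) (by fun_prop) fun x => by
        rw [AddCircle.coe_sub, hsec, sub_self]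
    have h1 := hn 0
    have h2 := hn (2 * π)
    simp only [AddCircle.coe_period, QuotientAddGroup.mk_zero] at h1 h2
    apply hT
    linarith
  · induction x using QuotientAddGroup.induction_on with | _ x
    rw [← hH', hQ, fourier_two_pi_coe, fourier_two_pi_coe, ← Complex.exp_add]
    congr 1
    push_cast
    ring
/-- Repeating the graph of `φ` on `[0, 1]` along the diagonal preserves the Lipschitz constant. -/
theorem abs_floor_add_comp_fract_sub_le {φ : ℝ → ℝ} {K : ℝ} (hK : 1 ≤ K) (h0 : φ 0 = 0)
    (h1 : φ 1 = 1) (hφ : ∀ s t, |φ s - φ t| ≤ K * |s - t|) (s t : ℝ) :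
    |(⌊s⌋ + φ (Int.fract s)) - (⌊t⌋ + φ (Int.fract t))| ≤ K * |s - t| := by
  wlog hst : s ≤ t generalizing s t
  · rw [abs_sub_comm, abs_sub_comm s]
    exact this t s (le_of_not_ge hst)
  have hs := Int.floor_add_fract s
  have ht := Int.floor_add_fract t
  rcases (Int.floor_mono hst).eq_or_lt with h | h
  · have e : s - t = Int.fract s - Int.fract t := by
      rw [h] at hs
      linarith
    rw [e, h, add_sub_add_left_eq_sub]
    exact hφ _ _
  · have h2 : (⌊s⌋ : ℝ) + 1 ≤ ⌊t⌋ := by exact_mod_cast h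
    have h3 := hφ (Int.fract t) 0
    have h4 := hφ 1 (Int.fract s)
    rw [h0, sub_zero, sub_zero, abs_of_nonneg (Int.fract_nonneg t)] at h3
    rw [h1, abs_of_nonneg (by linarith [Int.fract_lt_one s] : 0 ≤ 1 - Int.fract s)] at h4
    have h5 : (⌊t⌋ : ℝ) - ⌊s⌋ - 1 ≤ K * (⌊t⌋ - ⌊s⌋ - 1) := by nlinarith
    rw [abs_sub_comm s, abs_of_nonneg (sub_nonneg.2 hst), abs_sub_comm]
    have h6 : ((⌊t⌋ : ℝ) + φ (Int.fract t)) - (⌊s⌋ + φ (Int.fract s))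
        = φ (Int.fract t) + (⌊t⌋ - ⌊s⌋ - 1) + (1 - φ (Int.fract s)) := by ring
    have h7 : K * (t - s) = K * Int.fract t + K * (⌊t⌋ - ⌊s⌋ - 1) + K * (1 - Int.fract s) := by
      linear_combination K * hs - K * ht
    rw [h6, h7]
    refine (abs_add_three _ _ _).trans ?_
    rw [abs_of_nonneg (by linarith : (0 : ℝ) ≤ ⌊t⌋ - ⌊s⌋ - 1)]
    linarith

theorem norm_exp_ofReal_mul_I_sub_le (a b : ℝ) :
    ‖Complex.exp (a * Complex.I) - Complex.exp (b * Complex.I)‖ ≤ |a - b| := by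
  have h : Complex.exp (a * Complex.I) - Complex.exp (b * Complex.I)
      = (Complex.exp (Complex.I * (a - b : ℝ)) - 1) * Complex.exp (b * Complex.I) := by
    rw [sub_mul, ← Complex.exp_add, one_mul]
    congr 2
    push_cast
    ring
  rw [h, norm_mul, Complex.norm_exp_ofReal_mul_I, mul_one]
  exact Real.norm_exp_I_mul_ofReal_sub_one_le

/-- Degree-one maps of the circle to itself, the `n`-th of which is constant off an arc of length
proportional to `2⁻ⁿ`, these arcs being pairwise disjoint. -/
theorem exists_disjoint_degree_one_maps :
    ∃ b : ℕ → C(AddCircle (2 * π), ℝ), ∃ e : ℕ → AddCircle (2 * π) → ℂ,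
      (∀ n x, e n x = fourier 1 x * Complex.exp (b n x * Complex.I)) ∧
      (∀ (n M : ℕ) x y, ‖e n x ^ M - e n y ^ M‖ ≤ M * 2 ^ (n + 1) * dist x y) ∧
      ∀ x, ∃ n, ∀ m ≠ n, e m x = 1 := by
  have hπ := Real.pi_pos
  set φ : ℕ → ℝ → ℝ := fun n s => max 0 (min 1 (2 ^ (n + 1) * s - 1)) with hφ
  have hφ0 : ∀ n, φ n 0 = 0 := fun n => by simp [hφ]
  have hφ1 : ∀ n, φ n 1 = 1 := fun n => by
    have : (1 : ℝ) ≤ 2 ^ n := one_le_pow₀ (by norm_num)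
    have h2 : (1 : ℝ) ≤ 2 ^ (n + 1) * 1 - 1 := by rw [pow_succ]; linarith
    simp only [hφ]
    rw [min_eq_left h2]
    norm_num
  have hφL : ∀ n s t, |φ n s - φ n t| ≤ 2 ^ (n + 1) * |s - t| := by
    intro n s t
    calc |φ n s - φ n t| ≤ |min 1 (2 ^ (n + 1) * s - 1) - min 1 (2 ^ (n + 1) * t - 1)| := by
          simp only [hφ]
          exact (abs_max_sub_max_le_max 0 _ 0 _).trans (by simp)
      _ ≤ |(2 ^ (n + 1) * s - 1) - (2 ^ (n + 1) * t - 1)| :=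
          (abs_min_sub_min_le_max 1 _ 1 _).trans (by simp)
      _ = 2 ^ (n + 1) * |s - t| := by
          rw [sub_sub_sub_cancel_right, ← mul_sub, abs_mul, abs_of_pos (by positivity)]
  set c : ℕ → ℝ → ℝ := fun n s => ⌊s⌋ + φ n (Int.fract s) with hc
  have hcL : ∀ n s t, |c n s - c n t| ≤ 2 ^ (n + 1) * |s - t| := fun n s t =>
    abs_floor_add_comp_fract_sub_le (one_le_pow₀ (by norm_num)) (hφ0 n) (hφ1 n) (hφL n) s t
  have hcc : ∀ n, Continuous (c n) := fun n =>
    (LipschitzWith.of_dist_le' (K := 2 ^ (n + 1)) fun s t => by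
      rw [Real.dist_eq, Real.dist_eq]; exact hcL n s t).continuous
  have hb : ∀ n, ∃ Q : C(AddCircle (2 * π), ℝ), ∀ x : ℝ,
      Q (x : AddCircle (2 * π)) = 2 * π * c n (x / (2 * π)) - x := by
    intro n
    have := hcc n
    refine exists_continuousMap_coe_eq (by fun_prop) fun x => ?_
    have h1 : (x + 2 * π) / (2 * π) = x / (2 * π) + 1 := by field_simp
    simp only [hc, h1, Int.floor_add_one, Int.fract_add_one]
    push_cast
    ring
  choose b hb using hb
  set e : ℕ → AddCircle (2 * π) → ℂ := fun n x =>
    fourier 1 x * Complex.exp (b n x * Complex.I) with he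
  have hex : ∀ n (M : ℕ) (x : ℝ), e n (x : AddCircle (2 * π)) ^ M
      = Complex.exp ((M * (2 * π * c n (x / (2 * π))) : ℝ) * Complex.I) := by
    intro n M x
    simp only [he]
    rw [hb, fourier_two_pi_coe, ← Complex.exp_add, ← Complex.exp_nat_mul]
    congr 1
    push_cast
    ring
  refine ⟨b, e, fun _ _ => rfl, fun n M x y => ?_, fun x => ?_⟩
  · obtain ⟨x, y, rfl, rfl, hxy⟩ : ∃ a a' : ℝ, (a : AddCircle (2 * π)) = x ∧
        (a' : AddCircle (2 * π)) = y ∧ dist x y = |a - a'| := by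
      induction y using QuotientAddGroup.induction_on with | _ a'
      obtain ⟨t, ht⟩ := QuotientAddGroup.mk_surjective (x - (a' : AddCircle (2 * π)))
      have ht' : (t : AddCircle (2 * π)) = x - a' := ht
      have hr : ((round ((2 * π)⁻¹ * t) * (2 * π) : ℝ) : AddCircle (2 * π)) = 0 :=
        (AddCircle.coe_eq_zero_iff _).2 ⟨round ((2 * π)⁻¹ * t), by rw [zsmul_eq_mul]⟩
      refine ⟨a' + (t - round ((2 * π)⁻¹ * t) * (2 * π)), a', ?_, rfl, ?_⟩
      · rw [AddCircle.coe_add, AddCircle.coe_sub, hr, ht']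
        abel
      · rw [dist_eq_norm, ← ht, add_sub_cancel_left]
        exact AddCircle.norm_eq (2 * π)
    rw [hex, hex, hxy]
    refine (norm_exp_ofReal_mul_I_sub_le _ _).trans ?_
    have h1 := hcL n (x / (2 * π)) (y / (2 * π))
    rw [← sub_div, abs_div, abs_of_pos (by positivity : 0 < 2 * π)] at h1
    rw [← mul_sub, ← mul_sub, abs_mul, abs_mul, abs_of_pos (by positivity : 0 < 2 * π),
      Nat.abs_cast, mul_assoc (M : ℝ)]
    refine mul_le_mul_of_nonneg_left ?_ (by positivity)
    calc 2 * π * |c n (x / (2 * π)) - c n (y / (2 * π))|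
        ≤ 2 * π * (2 ^ (n + 1) * (|x - y| / (2 * π))) := by gcongr
      _ = 2 ^ (n + 1) * |x - y| := by field_simp
  · induction x using QuotientAddGroup.induction_on with | _ x
    set s := Int.fract (x / (2 * π)) with hs
    have key : ∀ m, (φ m s = 0 ∨ φ m s = 1) → e m (x : AddCircle (2 * π)) = 1 := by
      intro m hm
      have h1 := hex m 1 x
      rw [pow_one] at h1
      obtain ⟨k, hk⟩ : ∃ k : ℤ, c m (x / (2 * π)) = k := by
        rcases hm with hm | hm
        · exact ⟨⌊x / (2 * π)⌋, by simp [hc, ← hs, hm]⟩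
        · exact ⟨⌊x / (2 * π)⌋ + 1, by simp [hc, ← hs, hm]⟩
      rw [h1, Complex.exp_eq_one_iff]
      refine ⟨k, ?_⟩
      rw [hk]
      push_cast
      ring
    rcases (Int.fract_nonneg (x / (2 * π))).eq_or_lt with h0 | h0
    · exact ⟨0, fun m _ => key m (Or.inl (by rw [hs, ← h0, hφ0]))⟩
    obtain ⟨n, hn1, hn2⟩ := exists_nat_pow_near_of_lt_one h0 (Int.fract_lt_one (x / (2 * π))).le
      (by norm_num : (0 : ℝ) < 1 / 2) (by norm_num)
    rw [← hs] at hn1 hn2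
    refine ⟨n, fun m hm => key m ?_⟩
    simp only [hφ]
    rcases lt_or_gt_of_ne hm with h | h
    · left
      have h2 : (2 : ℝ) ^ (m + 1) * s ≤ 1 := by
        calc (2 : ℝ) ^ (m + 1) * s ≤ 2 ^ n * (1 / 2) ^ n := by
              gcongr
              · norm_num
              · exact h
          _ = 1 := by rw [← mul_pow]; norm_num
      rw [max_eq_left]
      exact (min_le_right _ _).trans (by linarith)
    · right
      have h2 : (2 : ℝ) ≤ 2 ^ (m + 1) * s := by
        calc (2 : ℝ) = 2 ^ (n + 2) * (1 / 2) ^ (n + 1) := by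
              rw [pow_succ, mul_right_comm, ← mul_pow]; norm_num
          _ ≤ 2 ^ (m + 1) * s := by
              refine mul_le_mul (pow_le_pow_right₀ (by norm_num) (by lia)) hn1.le (by positivity)
                (by positivity)
      rw [min_eq_left (by linarith)]
      norm_num

theorem exists_parameters {α : ℝ} (hα : α < 1 / 2) :
    ∃ (m : ℕ) (q : ℝ), 4 ≤ q ∧ q ^ 2 < m ∧ (2 * m : ℝ) ^ α < q := by
  obtain ⟨β, hβ, hβ'⟩ : ∃ β, max α 0 < β ∧ β < 1 / 2 := exists_between (max_lt hα (by norm_num))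
  have h0 : 0 < β := (le_max_right _ _).trans_lt hβ
  have hαβ : α < β := (le_max_left _ _).trans_lt hβ
  have key : ∀ γ : ℝ, 0 < γ → Tendsto (fun m : ℕ => (m : ℝ) ^ γ) atTop atTop := fun γ hγ =>
    (tendsto_rpow_atTop hγ).comp tendsto_natCast_atTop_atTop
  obtain ⟨m, h1, h2, h3, h4⟩ := (((key β h0).eventually_ge_atTop 4).and
    (((key (1 - 2 * β) (by linarith)).eventually_gt_atTop 1).and
    (((key (β - α) (by linarith)).eventually_gt_atTop (2 ^ α)).and
    (eventually_gt_atTop 0)))).exists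
  have hm : (0 : ℝ) < m := by exact_mod_cast h4
  refine ⟨m, (m : ℝ) ^ β, h1, ?_, ?_⟩
  · calc ((m : ℝ) ^ β) ^ 2 = (m : ℝ) ^ (2 * β) * 1 := by
          rw [← Real.rpow_mul_natCast hm.le, mul_comm, mul_one]; norm_num
      _ < (m : ℝ) ^ (2 * β) * (m : ℝ) ^ (1 - 2 * β) := by gcongr
      _ = m := by rw [← Real.rpow_add hm]; simp
  · calc (2 * m : ℝ) ^ α = 2 ^ α * (m : ℝ) ^ α := Real.mul_rpow (by norm_num) hm.le
      _ < (m : ℝ) ^ (β - α) * (m : ℝ) ^ α := by gcongr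
      _ = (m : ℝ) ^ β := by rw [← Real.rpow_add hm]; simp
theorem norm_div_norm_sub_le {E : Type*} [NormedAddCommGroup E] [NormedSpace ℝ E] {r : ℝ}
    (hr : 0 < r) {x y : E} (hx : r ≤ ‖x‖) (hy : r ≤ ‖y‖) :
    ‖‖x‖⁻¹ • x - ‖y‖⁻¹ • y‖ ≤ 2 / r * ‖x - y‖ := by
  have hx0 : 0 < ‖x‖ := hr.trans_le hx
  have hy0 : 0 < ‖y‖ := hr.trans_le hy
  have h1 : ‖x‖⁻¹ • x - ‖y‖⁻¹ • y = ‖x‖⁻¹ • (x - y) + ((‖x‖⁻¹ * (‖y‖ - ‖x‖)) * ‖y‖⁻¹) • y := by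
    have : (‖x‖⁻¹ * (‖y‖ - ‖x‖)) * ‖y‖⁻¹ = ‖x‖⁻¹ - ‖y‖⁻¹ := by field_simp
    rw [this]
    module
  have h2 : |‖y‖ - ‖x‖| ≤ ‖x - y‖ := by
    rw [abs_sub_comm]
    exact abs_norm_sub_norm_le x y
  calc ‖‖x‖⁻¹ • x - ‖y‖⁻¹ • y‖
      ≤ ‖x‖⁻¹ * ‖x - y‖ + ‖x‖⁻¹ * |‖y‖ - ‖x‖| := by
        rw [h1]
        refine (norm_add_le _ _).trans_eq ?_
        rw [norm_smul, norm_smul, norm_mul, norm_mul, norm_inv, norm_inv, norm_norm, norm_norm,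
          Real.norm_eq_abs, mul_assoc (‖x‖⁻¹ * _), inv_mul_cancel₀ hy0.ne', mul_one]
    _ ≤ ‖x‖⁻¹ * ‖x - y‖ + ‖x‖⁻¹ * ‖x - y‖ := by gcongr
    _ = 2 / ‖x‖ * ‖x - y‖ := by ring
    _ ≤ 2 / r * ‖x - y‖ := by gcongr

/-- If a continuous function `f` keeps distance at least `r` from `c` and winds `N` times around
`c`, then `|N| r² ≤ 8 ∑ |k| |ĝ(k)|²` for all rearrangements `g = f ∘ h`. -/
theorem abs_winding_mul_sq_le {f : AddCircle (2 * π) → ℂ} (hf : Continuous f) {c : ℂ} {r : ℝ}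
    (hr : 0 < r) (N : ℤ) (P : C(AddCircle (2 * π), ℝ))
    (hre : ∀ x, r ≤ ((f x - c) * (starRingEnd ℂ)
      (fourier N x * Complex.exp (P x * Complex.I))).re)
    (h : AddCircle (2 * π) ≃ₜ AddCircle (2 * π))
    (hs : Summable fun k : ℤ => ‖fourierCoeff (f ∘ h) k‖ ^ 2 * |(k : ℝ)|) :
    |(N : ℝ)| * r ^ 2 ≤ 8 * ∑' k : ℤ, ‖fourierCoeff (f ∘ h) k‖ ^ 2 * |(k : ℝ)| := by
  set E : AddCircle (2 * π) → ℂ := fun x => fourier N x * Complex.exp (P x * Complex.I) with hE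
  have hEc : Continuous E := by fun_prop
  have hEn : ∀ x, ‖E x‖ = 1 := fun x => by
    simp only [hE]
    rw [norm_mul, Complex.norm_exp_ofReal_mul_I, fourier_apply, Circle.norm_coe, one_mul]
  set w : AddCircle (2 * π) → ℂ := fun x => (f x - c) * (starRingEnd ℂ) (E x) with hw
  have hwc : Continuous w := by fun_prop
  have hwr : ∀ x, r ≤ (w x).re := hre
  have hwn : ∀ x, ‖w x‖ = ‖f x - c‖ := fun x => by
    simp only [hw]
    rw [norm_mul, RCLike.norm_conj, hEn, mul_one]
  have hfr : ∀ x, r ≤ ‖f x - c‖ := fun x => by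
    rw [← hwn]; exact (hwr x).trans (Complex.re_le_norm _)
  have hfw : ∀ x, f x - c = w x * E x := fun x => by
    simp only [hw]
    rw [mul_assoc, mul_comm ((starRingEnd ℂ) (E x)), Complex.mul_conj, Complex.normSq_eq_norm_sq,
      hEn]
    simp
  have hargc : Continuous fun x => Complex.arg (w x) :=
    continuous_iff_continuousAt.2 fun x =>
      (Complex.continuousAt_arg (Or.inl (hr.trans_le (hwr x)))).comp hwc.continuousAt
  obtain ⟨d, hd, Q, hQ⟩ := exists_degree_homeomorph h
  set u : AddCircle (2 * π) → ℂ := fun x => ‖f (h x) - c‖⁻¹ • (f (h x) - c) with hu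
  have huL : ∀ x y, ‖u x - u y‖ ≤ 2 / r * ‖(f ∘ h) x - (f ∘ h) y‖ := fun x y => by
    have := norm_div_norm_sub_le hr (hfr (h x)) (hfr (h y))
    rwa [sub_sub_sub_cancel_right] at this
  have huc : Continuous u := by
    have : ∀ x, ‖f (h x) - c‖ ≠ 0 := fun x => (hr.trans_le (hfr _)).ne'
    have h1 : Continuous fun x => ‖f (h x) - c‖ := by fun_prop
    exact (h1.inv₀ this).smul (by fun_prop)
  obtain ⟨hsu, hle⟩ := summable_fourierCoeff_of_norm_sub_le (by fun_prop) huc huL hs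
  have hdeg := abs_degree_le_two_mul_tsum (N * d)
    ⟨fun x => N * Q x + P (h x) + Complex.arg (w (h x)),
      (by fun_prop : Continuous fun x => N * Q x + P (h x)).add (hargc.comp h.continuous)⟩
    (g := u) (fun x => by
      have h0 : (‖w (h x)‖ : ℂ) ≠ 0 := by
        rw [hwn]; exact_mod_cast (hr.trans_le (hfr _)).ne'
      have h1 := Complex.norm_mul_exp_arg_mul_I (w (h x))
      simp only [hu, ContinuousMap.coe_mk]
      rw [Complex.real_smul, ← hwn, hfw]
      nth_rewrite 2 [← h1]
      simp only [hE]
      rw [hQ]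
      push_cast
      rw [add_mul, add_mul, Complex.exp_add, Complex.exp_add]
      field_simp) hsu
  have hd1 : (1 : ℝ) ≤ |(d : ℝ)| := by exact_mod_cast Int.one_le_abs hd
  have h3 : |(N : ℝ)| ≤ |((N * d : ℤ) : ℝ)| := by
    push_cast
    rw [abs_mul]
    exact le_mul_of_one_le_right (abs_nonneg _) hd1
  have h4 := h3.trans (hdeg.trans (mul_le_mul_of_nonneg_left hle (by norm_num)))
  calc |(N : ℝ)| * r ^ 2
      ≤ 2 * ((2 / r) ^ 2 * ∑' k : ℤ, ‖fourierCoeff (f ∘ h) k‖ ^ 2 * |(k : ℝ)|) * r ^ 2 := by gcongr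
    _ = 8 * ∑' k : ℤ, ‖fourierCoeff (f ∘ h) k‖ ^ 2 * |(k : ℝ)| := by field_simp; ring

theorem min_two_le_two_mul_rpow {α u : ℝ} (hα₀ : 0 < α) (hα : α ≤ 1) (hu : 0 ≤ u) :
    min 2 u ≤ 2 * u ^ α := by
  rcases le_total u 1 with h | h
  · have : u ^ (1 : ℝ) ≤ u ^ α := Real.rpow_le_rpow_of_exponent_ge' hu h hα₀.le hα
    rw [Real.rpow_one] at this
    exact (min_le_right _ _).trans (by linarith [Real.rpow_nonneg hu α])
  · exact (min_le_left _ _).trans (by linarith [Real.one_le_rpow h hα₀.le])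
/-- For every `0 < α < 1/2` there is a complex-valued `f ∈ Lip_α(𝕋)` such that for every
homeomorphism `h` of the circle, `f ∘ h ∉ W_2^{1/2}(𝕋)`. -/
theorem bohrPal_LipAlpha_not_W_half (α : ℝ) (hα₀ : 0 < α) (hα : α < 1 / 2) :
    ∃ f : AddCircle (2 * Real.pi) → ℂ,
      (∃ C : ℝ, ∀ t₁ t₂ : AddCircle (2 * Real.pi), ‖f t₁ - f t₂‖ ≤ C * dist t₁ t₂ ^ α) ∧
      ∀ h : AddCircle (2 * Real.pi) ≃ₜ AddCircle (2 * Real.pi),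
        ¬ Summable (fun k : ℤ => ‖fourierCoeff (f ∘ h) k‖ ^ 2 * |(k : ℝ)|) := by
  obtain ⟨m, q, hq4, hqm, hmq⟩ := exists_parameters hα
  obtain ⟨b, e, he, heL, he1⟩ := exists_disjoint_degree_one_maps
  have hq : 0 < q := by linarith
  set R : ℝ := q⁻¹ with hR
  have hR0 : 0 < R := inv_pos.2 hq
  have hR4 : R ≤ 1 / 4 := by
    rw [hR, one_div]
    exact inv_anti₀ (by norm_num) hq4
  have hR1 : R ≤ 1 := by linarith
  have hm : (0 : ℝ) < m := (by positivity : 0 < q ^ 2).trans hqm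
  have hm' : 0 < m := by exact_mod_cast hm
  have hec : ∀ n, Continuous (e n) := fun n => by
    rw [funext (he n)]; fun_prop
  have hen : ∀ n x, ‖e n x‖ = 1 := fun n x => by
    rw [he, norm_mul, Complex.norm_exp_ofReal_mul_I, fourier_apply, Circle.norm_coe, one_mul]
  have hz : ∀ n x, ‖e n x ^ m ^ n‖ = 1 := fun n x => by rw [norm_pow, hen, one_pow]
  set t : ℕ → AddCircle (2 * π) → ℂ := fun n x => (R ^ n : ℝ) * (1 - e n x ^ m ^ n) with ht
  have htn : ∀ n x, ‖t n x‖ ≤ 2 * R ^ n := fun n x => by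
    simp only [ht]
    rw [norm_mul, Complex.norm_real, Real.norm_eq_abs, abs_of_pos (by positivity), mul_comm]
    gcongr
    refine (norm_sub_le _ _).trans ?_
    rw [hz, norm_one]
    norm_num
  have hRs : Summable fun n : ℕ => 2 * R ^ n :=
    (summable_geometric_of_lt_one hR0.le (by linarith)).mul_left 2
  have hts : ∀ x, Summable fun n => t n x := fun x => hRs.of_norm_bounded fun n => htn n x
  set f : AddCircle (2 * π) → ℂ := fun x => ∑' n, t n x with hf
  have hfc : Continuous f := continuous_tsum (fun n => by
    have := hec n
    simp only [ht]
    fun_prop) hRs htn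
  refine ⟨f, ?_, fun h hs => ?_⟩
  · set ρ : ℝ := (2 * m : ℝ) ^ α / q with hρ
    have hρ0 : 0 ≤ ρ := by positivity
    have hρ1 : ρ < 1 := (div_lt_one hq).2 hmq
    refine ⟨2 * 2 ^ α * (1 - ρ)⁻¹, fun x y => ?_⟩
    have hd : (0 : ℝ) ≤ dist x y := dist_nonneg
    have hterm : ∀ n, ‖t n x - t n y‖ ≤ 2 * 2 ^ α * dist x y ^ α * ρ ^ n := by
      intro n
      have h1 : t n x - t n y = (R ^ n : ℝ) * (e n y ^ m ^ n - e n x ^ m ^ n) := by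
        simp only [ht]; ring
      have h2 : ‖e n y ^ m ^ n - e n x ^ m ^ n‖ ≤ min 2 (m ^ n * 2 ^ (n + 1) * dist x y) := by
        refine le_min ?_ ?_
        · refine (norm_sub_le _ _).trans ?_
          rw [hz, hz]
          norm_num
        · have := heL n (m ^ n) y x
          rw [dist_comm]
          exact_mod_cast this
      have h3 : ((m : ℝ) ^ n * 2 ^ (n + 1) * dist x y) ^ α
          = ((2 * m : ℝ) ^ α) ^ n * (2 ^ α * dist x y ^ α) := by
        have : (m : ℝ) ^ n * 2 ^ (n + 1) * dist x y = (2 * m) ^ n * (2 * dist x y) := by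
          rw [mul_pow]; ring
        rw [this, Real.mul_rpow (by positivity) (by positivity),
          Real.mul_rpow (by norm_num) hd, ← Real.rpow_natCast, ← Real.rpow_natCast,
          ← Real.rpow_mul (by positivity), ← Real.rpow_mul (by positivity), mul_comm (n : ℝ)]
      have h4 := h2.trans (min_two_le_two_mul_rpow hα₀ (by linarith) (by positivity))
      rw [h3] at h4
      rw [h1, norm_mul, Complex.norm_real, Real.norm_eq_abs, abs_of_pos (by positivity)]
      calc R ^ n * ‖e n y ^ m ^ n - e n x ^ m ^ n‖
          ≤ R ^ n * (2 * (((2 * m : ℝ) ^ α) ^ n * (2 ^ α * dist x y ^ α))) := by gcongr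
        _ = 2 * 2 ^ α * dist x y ^ α * ρ ^ n := by
          rw [hρ, hR, div_eq_mul_inv, mul_pow]; ring
    have hsum := (hasSum_geometric_of_lt_one hρ0 hρ1).mul_left (2 * 2 ^ α * dist x y ^ α)
    have := tsum_of_norm_bounded hsum hterm
    rw [(hts x).tsum_sub (hts y)] at this
    calc ‖f x - f y‖ ≤ 2 * 2 ^ α * dist x y ^ α * (1 - ρ)⁻¹ := this
      _ = 2 * 2 ^ α * (1 - ρ)⁻¹ * dist x y ^ α := by ring
  · set S := ∑' k : ℤ, ‖fourierCoeff (f ∘ h) k‖ ^ 2 * |(k : ℝ)|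
    have hbound : ∀ n : ℕ, ((m : ℝ) * R ^ 2) ^ n ≤ 32 * S := by
      intro n
      set N : ℤ := ∑ j ∈ Finset.range (n + 1), (m : ℤ) ^ j with hN
      let P : C(AddCircle (2 * π), ℝ) :=
        ⟨fun x => π + ∑ j ∈ Finset.range (n + 1), (m : ℝ) ^ j * b j x, by fun_prop⟩
      have hprod : ∀ x, fourier N x * Complex.exp (P x * Complex.I)
          = -∏ j ∈ Finset.range (n + 1), e j x ^ m ^ j := by
        intro x
        induction x using QuotientAddGroup.induction_on with | _ x
        have h1 : ∀ j, e j (x : AddCircle (2 * π)) ^ m ^ j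
            = Complex.exp (((m : ℝ) ^ j * x + (m : ℝ) ^ j * b j x : ℝ) * Complex.I) := by
          intro j
          rw [he, fourier_two_pi_coe, ← Complex.exp_add, ← Complex.exp_nat_mul]
          congr 1
          push_cast
          ring
        simp_rw [h1]
        rw [← Complex.exp_sum, fourier_two_pi_coe, ← Complex.exp_add, ← neg_one_mul,
          ← Complex.exp_pi_mul_I, ← Complex.exp_add]
        congr 1
        rw [← Finset.sum_mul, ← Complex.ofReal_sum, Finset.sum_add_distrib, ← Finset.sum_mul]
        simp only [P, hN, ContinuousMap.coe_mk]
        push_cast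
        ring
      have hw := abs_winding_mul_sq_le hfc (c := (R ^ n : ℝ)) (r := R ^ n / 2) (by positivity)
        N P (fun x => ?_) h hs
      · have h1 : (m : ℝ) ^ n ≤ |(N : ℝ)| := by
          refine le_trans ?_ (le_abs_self _)
          rw [hN]
          push_cast
          exact Finset.single_le_sum (f := fun j => (m : ℝ) ^ j) (fun j _ => by positivity)
            (Finset.self_mem_range_succ n)
        calc ((m : ℝ) * R ^ 2) ^ n = 4 * (m ^ n * (R ^ n / 2) ^ 2) := by
              rw [mul_pow, ← pow_mul, mul_comm 2 n, pow_mul]; ring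
          _ ≤ 4 * (|(N : ℝ)| * (R ^ n / 2) ^ 2) := by gcongr
          _ ≤ 4 * (8 * S) := by gcongr
          _ = 32 * S := by ring
      · rw [hprod]
        obtain ⟨k, hk⟩ := he1 x
        have hfx : f x = (R ^ k : ℝ) * (1 - e k x ^ m ^ k) :=
          tsum_eq_single k fun j hj => by simp [ht, hk j hj]
        have hzk := hz k x
        set z := e k x ^ m ^ k with hzdef
        have hzre := abs_le.1 (Complex.abs_re_le_norm z)
        rw [hzk] at hzre
        have hzz : z.re * z.re + z.im * z.im = 1 := by
          rw [← Complex.normSq_apply, Complex.normSq_eq_norm_sq, hzk, one_pow]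
        have hRn : 0 < R ^ n := by positivity
        rw [hfx]
        by_cases hkn : k ≤ n
        · have hle : R ^ n ≤ R ^ k := pow_le_pow_of_le_one hR0.le hR1 hkn
          rw [Finset.prod_eq_single k (fun j _ hj => by rw [hk j hj, one_pow])
            (fun hj => absurd (Finset.mem_range.2 (by lia)) hj), ← hzdef]
          simp only [Complex.mul_re, Complex.mul_im, Complex.sub_re, Complex.sub_im,
            Complex.ofReal_re, Complex.ofReal_im, Complex.one_re, Complex.one_im, map_neg,
            Complex.neg_re, Complex.neg_im, Complex.conj_re, Complex.conj_im]
          nlinarith [mul_nonneg (sub_nonneg.2 hle) (by linarith : 0 ≤ 1 - z.re)]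
        · have hle : R ^ k ≤ R ^ n * (1 / 4) :=
            calc R ^ k ≤ R ^ (n + 1) := pow_le_pow_of_le_one hR0.le hR1 (by lia)
              _ ≤ R ^ n * (1 / 4) := by rw [pow_succ]; gcongr
          have hRk : 0 < R ^ k := by positivity
          rw [Finset.prod_eq_one fun j hj => by
            rw [hk j (by have := Finset.mem_range.1 hj; lia), one_pow]]
          simp only [Complex.mul_re, Complex.mul_im, Complex.sub_re, Complex.sub_im,
            Complex.ofReal_re, Complex.ofReal_im, Complex.one_re, Complex.one_im, map_neg,
            map_one, Complex.neg_re, Complex.neg_im]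
          nlinarith
    have hgt : 1 < (m : ℝ) * R ^ 2 := by
      rw [hR, inv_pow, ← div_eq_mul_inv, one_lt_div (by positivity)]
      exact hqm
    obtain ⟨n, hn⟩ := pow_unbounded_of_one_lt (32 * S) hgt
    exact absurd (hbound n) (not_le.2 hn)
end
end
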